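/- arXiv:2504.06686 — 4 statements merged into one kernel-verified Lean document; each statement's English description precedes it below -/
import Mathlib

section
/- Dual quantitative Halmos-Savage Theorem for convex sets of probabilities: Assume l(𝕃^∞) = E'. Let 𝒫 and 𝒬 be convex sets of probability measures on (Ω,ℱ) with 𝒬 ≪≪ 𝒫. Suppose that for some fixed ε > 0 and δ > 0 the following holds: for each A ∈ ℱ such that there exists P ∈ 𝒫 with P(A) < δ, there exists Q ∈ 𝒬 with Q(A) < ε. Then for each P ∈ 𝒫 there exists Q ∈ 𝒬 such that for each A ∈ ℱ with P(A) < εδ one has Q(A) < 2ε. -/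
open MeasureTheory Filter Topology
open scoped ENNReal NNReal

namespace RobustHS


variable {Ω : Type*} [MeasurableSpace Ω]

/-- A property `p` holds `Ps`-quasi-surely if it holds outside of a measurable set which is
null for every measure in `Ps` (equivalently, outside of a polar set). -/
def QS (Ps : Set (Measure Ω)) (p : Ω → Prop) : Prop :=
  ∃ N : Set Ω, MeasurableSet N ∧ (∀ P ∈ Ps, P N = 0) ∧ ∀ ω, ω ∉ N → p ω

/-- Convexity of a set of measures. -/
def MConvex (Ps : Set (Measure Ω)) : Prop :=
  ∀ P ∈ Ps, ∀ P' ∈ Ps, ∀ t : ℝ≥0∞, t ≤ 1 → t • P + (1 - t) • P' ∈ Ps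

/-- `Qs ≪≪ Ps` : every `Q ∈ Qs` is absolutely continuous with respect to some `P ∈ Ps`. -/
def DominatedBy (Qs Ps : Set (Measure Ω)) : Prop := ∀ Q ∈ Qs, ∃ P ∈ Ps, Q ≪ P

/-- The underlying set of the space `E`: all finite signed measures which are absolutely
continuous with respect to at least one `P ∈ Ps`. -/
def Edom (Ps : Set (Measure Ω)) : Set (SignedMeasure Ω) :=
  {μ | ∃ P ∈ Ps, μ ≪ᵥ P.toENNRealVectorMeasure}

/-- The total variation norm of a finite signed measure. -/
noncomputable def tvnorm (μ : SignedMeasure Ω) : ℝ := (μ.totalVariation Set.univ).toReal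

/-- A nonempty convex set of probability measures on `Ω`. -/
structure ConvexProbFamily (Ω : Type*) [MeasurableSpace Ω] where
  sets : Set (Measure Ω)
  nonempty : sets.Nonempty
  isProb : ∀ P ∈ sets, IsProbabilityMeasure P
  convex : MConvex sets

/-- The space `E` as a submodule of the signed measures on `Ω`. -/
noncomputable def Esub (C : ConvexProbFamily Ω) : Submodule ℝ (SignedMeasure Ω) where
  carrier := Edom C.sets
  zero_mem' := by
    obtain ⟨P, hP⟩ := C.nonempty
    exact ⟨P, hP, fun s _ => rfl⟩
  add_mem' := by
    rintro μ₁ μ₂ ⟨P₁, hP₁, hac₁⟩ ⟨P₂, hP₂, hac₂⟩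
    refine ⟨(2⁻¹ : ℝ≥0∞) • P₁ + (1 - 2⁻¹ : ℝ≥0∞) • P₂,
      C.convex P₁ hP₁ P₂ hP₂ 2⁻¹ (by simp [ENNReal.inv_le_one]), ?_⟩
    intro s hs
    rw [VectorMeasure.add_apply]
    by_cases hm : MeasurableSet s
    · rw [Measure.toENNRealVectorMeasure_apply_measurable hm, Measure.add_apply,
        Measure.smul_apply, Measure.smul_apply, smul_eq_mul, smul_eq_mul,
        add_eq_zero, mul_eq_zero, mul_eq_zero] at hs
      have h1 : P₁ s = 0 := by
        rcases hs.1 with h | h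
        · exact absurd h (by simp)
        · exact h
      have h2 : P₂ s = 0 := by
        rcases hs.2 with h | h
        · exact absurd h (by simp [ENNReal.one_sub_inv_two])
        · exact h
      rw [hac₁ (by rw [Measure.toENNRealVectorMeasure_apply_measurable hm]; exact h1),
        hac₂ (by rw [Measure.toENNRealVectorMeasure_apply_measurable hm]; exact h2), add_zero]
    · rw [VectorMeasure.not_measurable _ hm, VectorMeasure.not_measurable _ hm, add_zero]
  smul_mem' := by
    rintro c μ ⟨P, hP, hac⟩
    exact ⟨P, hP, fun s hs => by rw [VectorMeasure.smul_apply, hac hs, smul_zero]⟩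



theorem exists_hahn (s : SignedMeasure Ω) :
    ∃ i : Set Ω, MeasurableSet i ∧ (0 ≤[i] s) ∧ (s ≤[iᶜ] 0) ∧ tvnorm s = s i - s iᶜ := by
  obtain ⟨i, hi₁, hi₂, hi₃, hpos, hneg⟩ := s.toJordanDecomposition_spec
  refine ⟨i, hi₁, hi₂, hi₃, ?_⟩
  rw [tvnorm, SignedMeasure.totalVariation, Measure.add_apply, hpos, hneg,
    SignedMeasure.toMeasureOfZeroLE_apply _ hi₂ hi₁ MeasurableSet.univ,
    SignedMeasure.toMeasureOfLEZero_apply _ hi₃ hi₁.compl MeasurableSet.univ]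
  rw [← ENNReal.coe_add, ENNReal.coe_toReal, NNReal.coe_add, NNReal.coe_mk, NNReal.coe_mk]
  rw [Set.inter_univ, Set.inter_univ]
  ring

theorem apply_sub_compl_le (s : SignedMeasure Ω) {A : Set Ω} (hA : MeasurableSet A) :
    s A - s Aᶜ ≤ tvnorm s := by
  obtain ⟨i, hi₁, hi₂, hi₃, heq⟩ := exists_hahn s
  rw [heq]
  have hAi : s A = s (A ∩ i) + s (A ∩ iᶜ) := by
    conv_lhs => rw [← Set.inter_union_compl A i]
    exact s.of_union (Set.disjoint_of_subset Set.inter_subset_right Set.inter_subset_right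
      disjoint_compl_right) (hA.inter hi₁) (hA.inter hi₁.compl)
  have hiA : s i = s (A ∩ i) + s (Aᶜ ∩ i) := by
    conv_lhs => rw [← Set.inter_union_compl i A, Set.inter_comm i A, Set.inter_comm i Aᶜ]
    exact s.of_union (Set.disjoint_of_subset Set.inter_subset_left Set.inter_subset_left
      disjoint_compl_right) (hA.inter hi₁) (hA.compl.inter hi₁)
  have hAci : s Aᶜ = s (Aᶜ ∩ i) + s (Aᶜ ∩ iᶜ) := by
    conv_lhs => rw [← Set.inter_union_compl Aᶜ i]
    exact s.of_union (Set.disjoint_of_subset Set.inter_subset_right Set.inter_subset_right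
      disjoint_compl_right) (hA.compl.inter hi₁) (hA.compl.inter hi₁.compl)
  have hic : s iᶜ = s (Aᶜ ∩ iᶜ) + s (A ∩ iᶜ) := by
    conv_lhs => rw [← Set.inter_union_compl iᶜ Aᶜ, Set.inter_comm iᶜ Aᶜ, Set.inter_comm iᶜ Aᶜᶜ,
      compl_compl]
    exact s.of_union (Set.disjoint_of_subset Set.inter_subset_left Set.inter_subset_left
      disjoint_compl_left) (hA.compl.inter hi₁.compl)
      (hA.inter hi₁.compl)
  have h1 : s (A ∩ iᶜ) ≤ 0 :=
    s.nonpos_of_restrict_le_zero (s.restrict_le_zero_subset hi₁.compl Set.inter_subset_right hi₃)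
  have h2 : 0 ≤ s (Aᶜ ∩ i) :=
    s.nonneg_of_zero_le_restrict (s.zero_le_restrict_subset hi₁ Set.inter_subset_right hi₂)
  have h3 : s (Aᶜ ∩ iᶜ) ≤ 0 :=
    s.nonpos_of_restrict_le_zero (s.restrict_le_zero_subset hi₁.compl Set.inter_subset_right hi₃)
  linarith

theorem tvnorm_add_le (s t : SignedMeasure Ω) : tvnorm (s + t) ≤ tvnorm s + tvnorm t := by
  obtain ⟨i, hi₁, hi₂, hi₃, heq⟩ := exists_hahn (s + t)
  rw [heq, VectorMeasure.add_apply, VectorMeasure.add_apply]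
  have h1 := apply_sub_compl_le s hi₁
  have h2 := apply_sub_compl_le t hi₁
  linarith

theorem tvnorm_eq_zero {s : SignedMeasure Ω} (h : tvnorm s = 0) : s = 0 := by
  have hfin : s.totalVariation Set.univ ≠ ⊤ := by
    have : IsFiniteMeasure s.totalVariation := by
      rw [SignedMeasure.totalVariation]; infer_instance
    exact measure_ne_top _ _
  have hzero : s.totalVariation Set.univ = 0 := by
    rwa [tvnorm, ENNReal.toReal_eq_zero_iff, or_iff_left hfin] at h
  ext A hA
  rw [VectorMeasure.zero_apply]
  exact s.null_of_totalVariation_zero (measure_mono_null (Set.subset_univ A) hzero)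

theorem tvnorm_smul (c : ℝ) (s : SignedMeasure Ω) : tvnorm (c • s) = |c| * tvnorm s := by
  rw [tvnorm, tvnorm, SignedMeasure.totalVariation, SignedMeasure.totalVariation,
    s.toJordanDecomposition_smul_real c, JordanDecomposition.real_smul_def]
  by_cases hc : 0 ≤ c
  · rw [if_pos hc, JordanDecomposition.smul_posPart, JordanDecomposition.smul_negPart]
    rw [Measure.add_apply, Measure.add_apply, Measure.smul_apply, Measure.smul_apply,
      ← smul_add, ENNReal.toReal_smul]
    rw [abs_of_nonneg hc, NNReal.smul_def, smul_eq_mul, Real.coe_toNNReal c hc]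
  · rw [if_neg hc, JordanDecomposition.neg_posPart, JordanDecomposition.neg_negPart,
      JordanDecomposition.smul_posPart, JordanDecomposition.smul_negPart]
    rw [Measure.add_apply, Measure.add_apply, Measure.smul_apply, Measure.smul_apply,
      ← smul_add, ENNReal.toReal_smul, add_comm]
    have : |c| = -c := abs_of_neg (not_le.1 hc)
    rw [this, NNReal.smul_def, smul_eq_mul,
      Real.coe_toNNReal _ (by linarith [not_le.1 hc] : (0:ℝ) ≤ -c), neg_mul]


theorem tvnorm_neg (s : SignedMeasure Ω) : tvnorm (-s) = tvnorm s := by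
  rw [tvnorm, tvnorm, SignedMeasure.totalVariation_neg]

noncomputable instance instNormedE (C : ConvexProbFamily Ω) :
    NormedAddCommGroup (Esub C) :=
  AddGroupNorm.toNormedAddCommGroup
    { toFun := fun μ => tvnorm (μ : SignedMeasure Ω)
      map_zero' := by simp [tvnorm, SignedMeasure.totalVariation_zero]
      add_le' := fun μ ν => tvnorm_add_le μ.1 ν.1
      neg' := fun μ => tvnorm_neg μ.1
      eq_zero_of_map_eq_zero' := fun μ h => Subtype.ext (tvnorm_eq_zero h) }

noncomputable instance instNormedSpaceE (C : ConvexProbFamily Ω) :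
    NormedSpace ℝ (Esub C) where
  norm_smul_le c μ := by
    have h : tvnorm ((c • μ : Esub C) : SignedMeasure Ω) = |c| * tvnorm (μ : SignedMeasure Ω) :=
      tvnorm_smul c μ.1
    calc ‖c • μ‖ = |c| * tvnorm (μ : SignedMeasure Ω) := h
    _ ≤ ‖c‖ * ‖μ‖ := by rw [Real.norm_eq_abs]; exact le_of_eq rfl

noncomputable def sintegral (h : Ω → ℝ) (μ : SignedMeasure Ω) : ℝ :=
  ∫ ω, h ω ∂μ.toJordanDecomposition.posPart - ∫ ω, h ω ∂μ.toJordanDecomposition.negPart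

def MemLinf (Ps : Set (Measure Ω)) (h : Ω → ℝ) : Prop :=
  Measurable h ∧ ∃ M : ℝ, QS Ps fun ω => |h ω| ≤ M

def Represents (C : ConvexProbFamily Ω) (y : Esub C →L[ℝ] ℝ) (h : Ω → ℝ) : Prop :=
  ∀ μ : Esub C, y μ = sintegral h (μ : SignedMeasure Ω)

def DualSurj (C : ConvexProbFamily Ω) : Prop :=
  ∀ y : Esub C →L[ℝ] ℝ, ∃ h : Ω → ℝ, MemLinf C.sets h ∧ Represents C y h

noncomputable def linfNorm (Ps : Set (Measure Ω)) (h : Ω → ℝ) : ℝ :=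
  sInf {M : ℝ | 0 ≤ M ∧ QS Ps fun ω => |h ω| ≤ M}

def LinfRep (C : ConvexProbFamily Ω) : Type _ := {f : Ω → ℝ // MemLinf C.sets f}

instance linfSetoid (C : ConvexProbFamily Ω) : Setoid (LinfRep C) where
  r f g := QS C.sets fun ω => f.1 ω = g.1 ω
  iseqv := by
    refine ⟨fun f => ⟨∅, MeasurableSet.empty, fun P _ => measure_empty, fun ω _ => rfl⟩,
      fun {f g} hfg => ?_, fun {f g k} h₁ h₂ => ?_⟩
    · obtain ⟨N, hN, hnull, h⟩ := hfg
      exact ⟨N, hN, hnull, fun ω hω => (h ω hω).symm⟩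
    · obtain ⟨N₁, hN₁, hnull₁, hh₁⟩ := h₁
      obtain ⟨N₂, hN₂, hnull₂, hh₂⟩ := h₂
      exact ⟨N₁ ∪ N₂, hN₁.union hN₂,
        fun P hP => measure_union_null (hnull₁ P hP) (hnull₂ P hP),
        fun ω hω => (hh₁ ω fun hmem => hω (Set.mem_union_left _ hmem)).trans
          (hh₂ ω fun hmem => hω (Set.mem_union_right _ hmem))⟩

def Linf (C : ConvexProbFamily Ω) : Type _ := Quotient (linfSetoid C)

theorem sintegral_congr (C : ConvexProbFamily Ω) {f g : Ω → ℝ}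
    (hfg : QS C.sets fun ω => f ω = g ω) {μ : SignedMeasure Ω} (hμ : μ ∈ Edom C.sets) :
    sintegral f μ = sintegral g μ := by
  obtain ⟨N, hN, hnull, heq⟩ := hfg
  obtain ⟨P, hP, hac⟩ := hμ
  have htv : μ.totalVariation ≪ P := by
    have := (SignedMeasure.absolutelyContinuous_ennreal_iff μ P.toENNRealVectorMeasure).mp hac
    rwa [VectorMeasure.ennrealToMeasure_toENNRealVectorMeasure] at this
  have htvN : μ.totalVariation N = 0 := htv (hnull P hP)
  rw [SignedMeasure.totalVariation, Measure.add_apply, add_eq_zero] at htvN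
  have hsub : {ω | ¬ f ω = g ω} ⊆ N := fun ω hω => by
    by_contra hN'
    exact hω (heq ω hN')
  have h1 : f =ᵐ[μ.toJordanDecomposition.posPart] g :=
    ae_iff.mpr (measure_mono_null hsub htvN.1)
  have h2 : f =ᵐ[μ.toJordanDecomposition.negPart] g :=
    ae_iff.mpr (measure_mono_null hsub htvN.2)
  rw [sintegral, sintegral, integral_congr_ae h1, integral_congr_ae h2]

noncomputable def pairing (C : ConvexProbFamily Ω) (μ : Esub C) : Linf C → ℝ :=
  Quotient.lift (fun f : LinfRep C => sintegral f.1 (μ : SignedMeasure Ω))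
    (fun _ _ hfg => sintegral_congr C hfg μ.2)

noncomputable instance instTopLinf (C : ConvexProbFamily Ω) : TopologicalSpace (Linf C) :=
  ⨅ μ : Esub C, TopologicalSpace.induced (pairing C μ) inferInstance



/-- The gain of the one-period portfolio with strategy `H`: `H · (S₁ - S₀)`. -/
def gain {d : ℕ} (H : Fin d → ℝ) (S0 : Fin d → ℝ) (S1 : Ω → Fin d → ℝ) (ω : Ω) : ℝ :=
  ∑ i, H i * (S1 ω i - S0 i)

/-- The robust no-arbitrage condition `NA(𝒫)` of Bouchard-Nutz (one-period case). -/
def NAcond (Ps : Set (Measure Ω)) {d : ℕ} (S0 : Fin d → ℝ) (S1 : Ω → Fin d → ℝ) : Prop :=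
  ∀ H : Fin d → ℝ, QS Ps (fun ω => 0 ≤ gain H S0 S1 ω) → QS Ps (fun ω => gain H S0 S1 ω = 0)

/-- The expectation `E_Q[f] = E_Q[f⁺] - E_Q[f⁻]`, valued in `EReal`, with the convention
`∞ - ∞ = -∞` (which holds for `EReal` subtraction). -/
noncomputable def convExp (Q : Measure Ω) (f : Ω → ℝ) : EReal :=
  ((∫⁻ ω, ENNReal.ofReal (f ω) ∂Q : ℝ≥0∞) : EReal) -
    ((∫⁻ ω, ENNReal.ofReal (-f ω) ∂Q : ℝ≥0∞) : EReal)

/-- The set `𝒬` of martingale measures dominated by some measure of `Ps`. -/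
def MartSet (Ps : Set (Measure Ω)) {d : ℕ} (S0 : Fin d → ℝ) (S1 : Ω → Fin d → ℝ) :
    Set (Measure Ω) :=
  {Q | IsProbabilityMeasure Q ∧ (∃ P ∈ Ps, Q ≪ P) ∧
    ∀ i : Fin d, convExp Q (fun ω => S1 ω i - S0 i) = 0}

section LargeMarket

variable {Ωs : ℕ → Type*} [∀ n, MeasurableSpace (Ωs n)]

/-- A robust large financial market: a sequence of one-period robust markets. -/
structure LargeMarket (Ωs : ℕ → Type*) [∀ n, MeasurableSpace (Ωs n)] where
  d : ℕ → ℕ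
  S0 : ∀ n, Fin (d n) → ℝ
  S1 : ∀ n, Ωs n → Fin (d n) → ℝ
  meas_S1 : ∀ n i, Measurable fun ω => S1 n ω i

/-- Asymptotic arbitrage of the first kind for the sequence of uncertainty sets `Ps`. -/
def AA1 (M : LargeMarket Ωs) (Ps : ∀ n, Set (Measure (Ωs n))) : Prop :=
  ∃ nk : ℕ → ℕ, StrictMono nk ∧
    ∃ H : ∀ k, Fin (M.d (nk k)) → ℝ, ∃ c : ℕ → ℝ,
      (∀ k, 0 < c k) ∧ Tendsto c atTop (nhds 0) ∧
      (∀ k, QS (Ps (nk k)) fun ω => -(c k) ≤ gain (H k) (M.S0 (nk k)) (M.S1 (nk k)) ω) ∧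
      ∃ α : ℝ, 0 < α ∧ ∃ Pk : ∀ k, Measure (Ωs (nk k)),
        (∀ k, Pk k ∈ Ps (nk k)) ∧
        ∀ k, ENNReal.ofReal α ≤ Pk k {ω | α ≤ gain (H k) (M.S0 (nk k)) (M.S1 (nk k)) ω}

/-- No asymptotic arbitrage of the first kind. -/
def NAA1 (M : LargeMarket Ωs) (Ps : ∀ n, Set (Measure (Ωs n))) : Prop := ¬ AA1 M Ps

/-- Asymptotic arbitrage of the second kind. -/
def AA2 (M : LargeMarket Ωs) (Ps : ∀ n, Set (Measure (Ωs n))) : Prop :=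
  ∃ nk : ℕ → ℕ, StrictMono nk ∧
    ∃ H : ∀ k, Fin (M.d (nk k)) → ℝ,
      (∀ k, QS (Ps (nk k)) fun ω => -1 ≤ gain (H k) (M.S0 (nk k)) (M.S1 (nk k)) ω) ∧
      ∃ α : ℝ, 0 < α ∧ ∃ Pk : ∀ k, Measure (Ωs (nk k)),
        (∀ k, Pk k ∈ Ps (nk k)) ∧
        Tendsto (fun k => Pk k {ω | α ≤ gain (H k) (M.S0 (nk k)) (M.S1 (nk k)) ω})
          atTop (nhds 1)

/-- No asymptotic arbitrage of the second kind. -/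
def NAA2 (M : LargeMarket Ωs) (Ps : ∀ n, Set (Measure (Ωs n))) : Prop := ¬ AA2 M Ps

/-- `(Pₙ)` is contiguous with respect to `(Qₙ)`. -/
def Contiguous (P Q : ∀ n, Measure (Ωs n)) : Prop :=
  ∀ A : ∀ n, Set (Ωs n), (∀ n, MeasurableSet (A n)) →
    Tendsto (fun n => Q n (A n)) atTop (nhds 0) → Tendsto (fun n => P n (A n)) atTop (nhds 0)

/-- The sequence of sets `R n` of probability measures is weakly contiguous
with respect to `(Pₙ)`. -/
def WeaklyContiguous (R : ∀ n, Set (Measure (Ωs n))) (P : ∀ n, Measure (Ωs n)) : Prop :=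
  ∀ ε : ℝ, 0 < ε → ∃ δ : ℝ, 0 < δ ∧ ∃ Q : ∀ n, Measure (Ωs n), (∀ n, Q n ∈ R n) ∧
    ∀ n, ∀ A : Set (Ωs n), MeasurableSet A →
      P n A < ENNReal.ofReal δ → Q n A < ENNReal.ofReal ε

end LargeMarket



theorem exists_forall_weakDual_apply_lt {E : Type*} [NormedAddCommGroup E] [NormedSpace ℝ E]
    {K : Set (WeakDual ℝ E)} (hKne : K.Nonempty) (hKconv : Convex ℝ K) (hK : IsCompact K)
    {Y : Set E} (hY : Convex ℝ Y) {c : ℝ} (h : ∀ y ∈ K, ∃ x ∈ Y, y x < c) :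
    ∃ x ∈ Y, ∀ y ∈ K, y x < c := by
  obtain ⟨t, ht⟩ := hK.elim_finite_subcover (fun x : Y => {y : WeakDual ℝ E | y x < c})
    (fun x => isOpen_lt (WeakDual.eval_continuous _) continuous_const)
    (fun y hy => by
      obtain ⟨x, hx, hyx⟩ := h y hy
      exact Set.mem_iUnion.2 ⟨⟨x, hx⟩, hyx⟩)
  have hcont (x : E) : Continuous fun y : WeakDual ℝ E => -y x :=
    (WeakDual.eval_continuous x).neg
  obtain ⟨x, hx, hlt⟩ := Sion.exists_lt_iInf_of_lt_iInf_of_finite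
    (f := fun (y : WeakDual ℝ E) (x : E) => -y x) (t := -c) hKne hK
    (fun x _ => (hcont x).lowerSemicontinuous.lowerSemicontinuousOn _)
    (fun x _ => ConvexOn.quasiconvexOn ⟨hKconv, fun y _ z _ a b _ _ _ => by
      change -(a • y x + b • z x) ≤ a • -y x + b • -z x
      simp only [smul_eq_mul]; linarith⟩)
    hY
    (fun y _ => (show Continuous fun x => -y x from
      (map_continuous y).neg).upperSemicontinuous.upperSemicontinuousOn _)
    (fun y _ => ConcaveOn.quasiconcaveOn ⟨hY, fun x _ z _ a b _ _ _ => by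
      simp only [map_add, map_smul, smul_eq_mul]; linarith⟩)
    hKconv (t.finite_toSet.image Subtype.val) (by rintro _ ⟨x, -, rfl⟩; exact x.2)
    (fun y hy => by
      obtain ⟨x, hx, hyx⟩ := Set.mem_iUnion₂.1 (ht hy)
      exact ⟨x, ⟨x, hx, rfl⟩, neg_lt_neg hyx⟩)
  exact ⟨x, hx, fun y hy => neg_lt_neg_iff.1 (hlt y hy)⟩

theorem abs_apply_le_tvnorm (s : SignedMeasure Ω) {A : Set Ω} (hA : MeasurableSet A) :
    |s A| ≤ tvnorm s := by
  have key (r : SignedMeasure Ω) : r A ≤ tvnorm r := by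
    have h1 := apply_sub_compl_le r hA
    have h2 := apply_sub_compl_le r MeasurableSet.univ
    rw [Set.compl_univ, r.empty, ← Set.union_compl_self A,
      r.of_union disjoint_compl_right hA hA.compl] at h2
    linarith
  have h := key (-s)
  rw [tvnorm_neg, _root_.neg_apply] at h
  exact abs_le.2 ⟨by linarith, key s⟩

theorem toJordanDecomposition_toSignedMeasure (m : Measure Ω) [IsFiniteMeasure m] :
    m.toSignedMeasure.toJordanDecomposition = ⟨m, 0, Measure.MutuallySingular.zero_right⟩ :=
  SignedMeasure.toJordanDecomposition_eq (by simp [JordanDecomposition.toSignedMeasure])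

theorem sintegral_toSignedMeasure (h : Ω → ℝ) (m : Measure Ω) [IsFiniteMeasure m] :
    sintegral h m.toSignedMeasure = ∫ ω, h ω ∂m := by
  simp [sintegral, toJordanDecomposition_toSignedMeasure]

theorem tvnorm_toSignedMeasure (m : Measure Ω) [IsFiniteMeasure m] :
    tvnorm m.toSignedMeasure = m.real Set.univ := by
  simp [tvnorm, SignedMeasure.totalVariation, toJordanDecomposition_toSignedMeasure,
    Measure.real]

/-- A finite measure dominated by some member of the family, as an element of `E`. -/
noncomputable def toEsub (C : ConvexProbFamily Ω) (m : Measure Ω) [IsFiniteMeasure m]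
    (hm : ∃ P ∈ C.sets, m ≪ P) : Esub C :=
  ⟨m.toSignedMeasure, by
    obtain ⟨P, hP, hac⟩ := hm
    refine ⟨P, hP, VectorMeasure.AbsolutelyContinuous.mk fun A hA hPA => ?_⟩
    rw [Measure.toENNRealVectorMeasure_apply_measurable hA] at hPA
    rw [Measure.toSignedMeasure_apply_measurable hA, Measure.real, hac hPA,
      ENNReal.toReal_zero]⟩

/-- Evaluation at a measurable set, as an element of the dual of `E`. -/
noncomputable def evalCLM (C : ConvexProbFamily Ω) {A : Set Ω} (hA : MeasurableSet A) :
    Esub C →L[ℝ] ℝ :=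
  LinearMap.mkContinuous
    { toFun := fun μ => (μ : SignedMeasure Ω) A
      map_add' := fun _ _ => rfl
      map_smul' := fun _ _ => rfl } 1
    fun μ => (abs_apply_le_tvnorm (μ : SignedMeasure Ω) hA).trans_eq (one_mul _).symm

theorem norm_evalCLM_le (C : ConvexProbFamily Ω) {A : Set Ω} (hA : MeasurableSet A) :
    ‖evalCLM C hA‖ ≤ 1 :=
  LinearMap.mkContinuous_norm_le _ zero_le_one _

theorem norm_toEsub (C : ConvexProbFamily Ω) (m : Measure Ω) [IsFiniteMeasure m]
    (hm : ∃ P ∈ C.sets, m ≪ P) : ‖toEsub C m hm‖ = m.real Set.univ :=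
  tvnorm_toSignedMeasure m

theorem toEsub_restrict_add_compl (C : ConvexProbFamily Ω) (m : Measure Ω) [IsFiniteMeasure m]
    (hm : ∃ P ∈ C.sets, m ≪ P) {A : Set Ω} (hA : MeasurableSet A)
    (h₁ : ∃ P ∈ C.sets, m.restrict A ≪ P) (h₂ : ∃ P ∈ C.sets, m.restrict Aᶜ ≪ P) :
    toEsub C (m.restrict A) h₁ + toEsub C (m.restrict Aᶜ) h₂ = toEsub C m hm := by
  refine Subtype.ext ?_
  change (m.restrict A).toSignedMeasure + (m.restrict Aᶜ).toSignedMeasure = m.toSignedMeasure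
  rw [← Measure.toSignedMeasure_add]
  exact Measure.toSignedMeasure_congr (Measure.restrict_add_restrict_compl hA)

theorem exists_restrict_ac {C : ConvexProbFamily Ω} {m : Measure Ω}
    (hm : ∃ P ∈ C.sets, m ≪ P) (A : Set Ω) : ∃ P ∈ C.sets, m.restrict A ≪ P :=
  let ⟨P, hP, hac⟩ := hm
  ⟨P, hP, Measure.absolutelyContinuous_of_le Measure.restrict_le_self |>.trans hac⟩

theorem MemLinf.integrable {C : ConvexProbFamily Ω} {h : Ω → ℝ} (hh : MemLinf C.sets h)
    {m : Measure Ω} [IsFiniteMeasure m] (hm : ∃ P ∈ C.sets, m ≪ P) : Integrable h m := by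
  obtain ⟨hmeas, M, N, -, hnull, hbd⟩ := hh
  obtain ⟨P, hP, hac⟩ := hm
  refine Integrable.of_bound hmeas.aestronglyMeasurable M (ae_iff.2 (measure_mono_null ?_
    (hac (hnull P hP))))
  intro ω hω
  by_contra hN
  exact hω (hbd ω hN)

theorem Represents.apply_toEsub {C : ConvexProbFamily Ω} {y : Esub C →L[ℝ] ℝ} {h : Ω → ℝ}
    (hy : Represents C y h) (m : Measure Ω) [IsFiniteMeasure m]
    (hm : ∃ P ∈ C.sets, m ≪ P) : y (toEsub C m hm) = ∫ ω, h ω ∂m :=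
  (hy _).trans (sintegral_toSignedMeasure h m)

/-- The tests `y` in the unit ball of the dual of `E` which are nonnegative on measures and
whose size under `P` is at most `c`. -/
def tests (C : ConvexProbFamily Ω) {P : Measure Ω} [IsFiniteMeasure P] (hP : P ∈ C.sets)
    (c : ℝ) : Set (WeakDual ℝ (Esub C)) :=
  WeakDual.toStrongDual ⁻¹' Metric.closedBall 0 1 ∩
    ({y | ∀ μ : Esub C, (∀ A, 0 ≤ (μ : SignedMeasure Ω) A) → 0 ≤ y μ} ∩
      {y | y (toEsub C P ⟨P, hP, Measure.AbsolutelyContinuous.rfl⟩) ≤ c})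

theorem isCompact_tests (C : ConvexProbFamily Ω) {P : Measure Ω} [IsFiniteMeasure P]
    (hP : P ∈ C.sets) (c : ℝ) : IsCompact (tests C hP c) := by
  refine (WeakDual.isCompact_closedBall 0 1).inter_right (IsClosed.inter ?_
    (isClosed_le (WeakDual.eval_continuous _) continuous_const))
  simp only [Set.ofPred_forall]
  exact isClosed_iInter fun μ => isClosed_iInter fun _ =>
    isClosed_le continuous_const (WeakDual.eval_continuous _)

theorem convex_tests (C : ConvexProbFamily Ω) {P : Measure Ω} [IsFiniteMeasure P]
    (hP : P ∈ C.sets) (c : ℝ) : Convex ℝ (tests C hP c) := by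
  rintro y ⟨hy₁, hy₂, hy₃⟩ z ⟨hz₁, hz₂, hz₃⟩ a b ha hb hab
  refine ⟨?_, fun μ hμ => ?_, ?_⟩
  · exact convex_closedBall (0 : StrongDual ℝ (Esub C)) 1 hy₁ hz₁ ha hb hab
  · exact add_nonneg (mul_nonneg ha (hy₂ μ hμ)) (mul_nonneg hb (hz₂ μ hμ))
  · calc _ ≤ a * c + b * c :=
        add_le_add (mul_le_mul_of_nonneg_left hy₃ ha) (mul_le_mul_of_nonneg_left hz₃ hb)
      _ = c := by rw [← add_mul, hab, one_mul]

theorem toEsub_nonneg (C : ConvexProbFamily Ω) (m : Measure Ω) [IsFiniteMeasure m]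
    (hm : ∃ P ∈ C.sets, m ≪ P) (A : Set Ω) : 0 ≤ (toEsub C m hm : SignedMeasure Ω) A := by
  change 0 ≤ m.toSignedMeasure A
  rw [Measure.toSignedMeasure_apply]
  split_ifs <;> positivity

theorem evalCLM_mem_tests (C : ConvexProbFamily Ω) {P : Measure Ω} [IsFiniteMeasure P]
    (hP : P ∈ C.sets) {c : ℝ} {A : Set Ω} (hA : MeasurableSet A) (hPA : P.real A ≤ c) :
    StrongDual.toWeakDual (evalCLM C hA) ∈ tests C hP c :=
  ⟨by simpa using norm_evalCLM_le C hA, fun _ hμ => hμ A,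
    (Measure.toSignedMeasure_apply_measurable hA).trans_le hPA⟩

theorem tests_nonempty (C : ConvexProbFamily Ω) {P : Measure Ω} [IsFiniteMeasure P]
    (hP : P ∈ C.sets) {c : ℝ} (hc : 0 ≤ c) : (tests C hP c).Nonempty :=
  ⟨_, evalCLM_mem_tests C hP MeasurableSet.empty (by simpa using hc)⟩

/-- Each test of size at most `εδ` splits along a superlevel set of its representing function
into a set of measure less than `δ` and a remainder bounded by `ε`. -/
theorem exists_superlevel_of_mem_tests {C : ConvexProbFamily Ω} (hsurj : DualSurj C)
    {P : Measure Ω} [IsFiniteMeasure P] (hP : P ∈ C.sets) {ε δ : ℝ} (hε : 0 < ε) (hδ : 0 < δ)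
    {y : WeakDual ℝ (Esub C)} (hy : y ∈ tests C hP (ε * δ)) :
    ∃ A : Set Ω, MeasurableSet A ∧ P.real A < δ ∧
      ∀ (Q : Measure Ω) [IsProbabilityMeasure Q] (hQ : ∃ P ∈ C.sets, Q ≪ P),
        y (toEsub C Q hQ) ≤ Q.real A + ε := by
  obtain ⟨hy₁, hy₂, hy₃⟩ := hy
  obtain ⟨h, hh, hrep⟩ := hsurj (WeakDual.toStrongDual y)
  have hApply (m : Measure Ω) [IsFiniteMeasure m] (hm : ∃ P ∈ C.sets, m ≪ P) :
      y (toEsub C m hm) = ∫ ω, h ω ∂m := hrep.apply_toEsub m hm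
  have hA : MeasurableSet {ω | ε < h ω} := measurableSet_lt measurable_const hh.1
  refine ⟨{ω | ε < h ω}, hA, ?_, fun Q _ hQ => ?_⟩
  · have hP' : ∃ P' ∈ C.sets, P ≪ P' := ⟨P, hP, Measure.AbsolutelyContinuous.rfl⟩
    have hsplit := congrArg y (toEsub_restrict_add_compl C P hP' hA
      (exists_restrict_ac hP' _) (exists_restrict_ac hP' _))
    rw [map_add, hApply (P.restrict {ω | ε < h ω})] at hsplit
    have hcompl := hy₂ _ (toEsub_nonneg C (P.restrict {ω | ε < h ω}ᶜ) (exists_restrict_ac hP' _))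
    have hle : ∫ ω in {ω | ε < h ω}, h ω ∂P ≤ ε * δ := by
      have : y (toEsub C P hP') ≤ ε * δ := hy₃
      linarith
    rcases (measureReal_nonneg (μ := P) (s := {ω | ε < h ω})).eq_or_lt with h0 | hpos
    · rwa [← h0]
    · have hint := hh.integrable hP'
      have hlt : ∫ ω in {ω | ε < h ω}, ε ∂P < ∫ ω in {ω | ε < h ω}, h ω ∂P := by
        rw [← sub_pos, ← integral_sub hint.integrableOn (integrable_const _),
          setIntegral_pos_iff_support_of_nonneg_ae]
        · refine (ENNReal.toReal_pos_iff.1 hpos).1.trans_le (measure_mono fun ω hω => ?_)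
          exact ⟨(sub_pos.2 hω).ne', hω⟩
        · exact (ae_restrict_iff' hA).2 (ae_of_all _ fun ω hω => (sub_pos.2 hω).le)
        · exact (hint.sub (integrable_const _)).integrableOn
      rw [setIntegral_const, smul_eq_mul, mul_comm] at hlt
      exact lt_of_mul_lt_mul_left (hlt.trans_le hle) hε.le
  · rw [← toEsub_restrict_add_compl C Q hQ hA (exists_restrict_ac hQ _)
      (exists_restrict_ac hQ _), map_add]
    refine add_le_add ?_ ?_
    · have hnorm : ‖WeakDual.toStrongDual y‖ ≤ 1 := by simpa using hy₁
      calc y (toEsub C (Q.restrict {ω | ε < h ω}) _)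
          ≤ ‖WeakDual.toStrongDual y (toEsub C (Q.restrict {ω | ε < h ω})
              (exists_restrict_ac hQ _))‖ := Real.le_norm_self _
        _ ≤ 1 * ‖toEsub C (Q.restrict {ω | ε < h ω}) (exists_restrict_ac hQ _)‖ :=
            ContinuousLinearMap.le_of_opNorm_le _ hnorm _
        _ = Q.real {ω | ε < h ω} := by
            rw [one_mul, norm_toEsub, measureReal_restrict_apply_univ]
    · rw [hApply]
      calc ∫ ω in {ω | ε < h ω}ᶜ, h ω ∂Q ≤ ∫ ω in {ω | ε < h ω}ᶜ, ε ∂Q :=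
            setIntegral_mono_on (hh.integrable hQ).integrableOn (integrable_const _).integrableOn
              hA.compl fun ω hω => not_lt.1 hω
        _ ≤ ε := by
            rw [setIntegral_const, smul_eq_mul]
            exact mul_le_of_le_one_left hε.le measureReal_le_one

/-- The elements of `E` given by the members of a set of measures. -/
def inducedSet (C : ConvexProbFamily Ω) (Qs : Set (Measure Ω)) : Set (Esub C) :=
  {ν | ∃ Q ∈ Qs, ∀ A, MeasurableSet A → (ν : SignedMeasure Ω) A = Q.real A}

theorem convex_inducedSet (C : ConvexProbFamily Ω) {Qs : Set (Measure Ω)}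
    (hQprob : ∀ Q ∈ Qs, IsProbabilityMeasure Q) (hQconv : MConvex Qs) :
    Convex ℝ (inducedSet C Qs) := by
  rintro ν ⟨Q, hQ, hν⟩ ξ ⟨R, hR, hξ⟩ a b ha hb hab
  have := hQprob Q hQ
  have := hQprob R hR
  have hb' : 1 - ENNReal.ofReal a = ENNReal.ofReal b := by
    rw [← ENNReal.ofReal_one, ← ENNReal.ofReal_sub _ ha, ← hab, add_sub_cancel_left]
  refine ⟨_, hQconv Q hQ R hR (ENNReal.ofReal a)
    (ENNReal.ofReal_le_one.2 (by linarith)), fun A hA => ?_⟩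
  change a * (ν : SignedMeasure Ω) A + b * (ξ : SignedMeasure Ω) A = _
  rw [hb', hν A hA, hξ A hA, Measure.real, Measure.real, Measure.real, Measure.add_apply,
    Measure.smul_apply, Measure.smul_apply, smul_eq_mul, smul_eq_mul,
    ENNReal.toReal_add (by finiteness) (by finiteness), ENNReal.toReal_mul, ENNReal.toReal_mul,
    ENNReal.toReal_ofReal ha, ENNReal.toReal_ofReal hb]

/-- **Dual quantitative Halmos-Savage Theorem for convex sets of probabilities.**
Assume `l(𝕃^∞) = E'` (`DualSurj C`).  Let `𝒫 = C.sets` and `Qs` be convex sets of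
probability measures with `Qs ≪≪ 𝒫`.  If for some fixed `ε, δ > 0` every `A ∈ ℱ` with
`P(A) < δ` for some `P ∈ 𝒫` admits `Q ∈ Qs` with `Q(A) < ε`, then for each `P ∈ 𝒫` there
is `Q ∈ Qs` such that `P(A) < εδ` implies `Q(A) < 2ε` for every `A ∈ ℱ`. -/
theorem dual_quantitative_halmos_savage {Ω : Type*} [MeasurableSpace Ω]
    (C : ConvexProbFamily Ω) (Qs : Set (Measure Ω))
    (hQprob : ∀ Q ∈ Qs, IsProbabilityMeasure Q) (hQconv : MConvex Qs)
    (hdom : DominatedBy Qs C.sets) (hsurj : DualSurj C)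
    (ε δ : ℝ) (hε : 0 < ε) (hδ : 0 < δ)
    (hHS : ∀ A : Set Ω, MeasurableSet A → (∃ P ∈ C.sets, P A < ENNReal.ofReal δ) →
      ∃ Q ∈ Qs, Q A < ENNReal.ofReal ε) :
    ∀ P ∈ C.sets, ∃ Q ∈ Qs, ∀ A : Set Ω, MeasurableSet A →
      P A < ENNReal.ofReal (ε * δ) → Q A < ENNReal.ofReal (2 * ε) := by
  intro P hP
  have := C.isProb P hP
  obtain ⟨ν, ⟨Q, hQ, hν⟩, hlt⟩ := exists_forall_weakDual_apply_lt
    (tests_nonempty C hP (mul_pos hε hδ).le) (convex_tests C hP (ε * δ))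
    (isCompact_tests C hP (ε * δ)) (convex_inducedSet C hQprob hQconv) (c := 2 * ε)
    (fun y hy => by
      obtain ⟨A, hA, hPA, hyA⟩ := exists_superlevel_of_mem_tests hsurj hP hε hδ hy
      obtain ⟨Q, hQ, hQA⟩ := hHS A hA
        ⟨P, hP, (ENNReal.lt_ofReal_iff_toReal_lt (measure_ne_top P A)).2 hPA⟩
      have := hQprob Q hQ
      have hQA' : Q.real A < ε := (ENNReal.lt_ofReal_iff_toReal_lt (measure_ne_top Q A)).1 hQA
      exact ⟨toEsub C Q (hdom Q hQ),
        ⟨Q, hQ, fun B hB => Measure.toSignedMeasure_apply_measurable hB⟩,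
        (hyA Q (hdom Q hQ)).trans_lt (by linarith)⟩)
  have := hQprob Q hQ
  refine ⟨Q, hQ, fun A hA hPA => ?_⟩
  rw [ENNReal.lt_ofReal_iff_toReal_lt (measure_ne_top _ _)] at hPA ⊢
  exact (hν A hA).symm.trans_lt (hlt _ (evalCLM_mem_tests C hP hA hPA.le))

end RobustHS
end

section
/- Robust FTAP for large financial markets with NAA1: Let a robust large financial market be given such that for each n, l(𝕃^∞(𝒫^n)) = E_n' and NA(𝒫^n) holds. Then NAA1(𝒫^n) holds if and only if for each sequence (P^n)_{n≥1} with P^n ∈ 𝒫^n for all n, there exists a sequence (Q^n)_{n≥1} with Q^n ∈ 𝒬^n for all n, such that (P^n)_{n≥1} is contiguous with respect to (Q^n)_{n≥1}. -/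
open MeasureTheory Filter Topology
open scoped ENNReal NNReal

namespace RobustHS


variable {Ω : Type*} [MeasurableSpace Ω]

/-- The logistic loss. -/
noncomputable def loss (y : ℝ) : ℝ := Real.log (1 + Real.exp (-y))

/-- The slope of the logistic loss, up to sign. -/
noncomputable def lossSlope (y : ℝ) : ℝ := (1 + Real.exp y)⁻¹

/-- Logistic loss with an extra penalty of strength `μ` for values below `-1`. -/
noncomputable def penLoss (μ x : ℝ) : ℝ := loss x + loss (μ * (x + 1))

/-- The slope of `penLoss μ`, up to sign. -/
noncomputable def penSlope (μ x : ℝ) : ℝ := lossSlope x + μ * lossSlope (μ * (x + 1))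

lemma lossSlope_pos (y : ℝ) : 0 < lossSlope y := by
  unfold lossSlope; positivity

lemma lossSlope_le_one (y : ℝ) : lossSlope y ≤ 1 :=
  inv_le_one_of_one_le₀ (by linarith [Real.exp_pos y])

lemma lossSlope_anti {x y : ℝ} (h : x ≤ y) : lossSlope y ≤ lossSlope x := by
  unfold lossSlope
  gcongr

lemma mul_lossSlope_le_one (y : ℝ) : y * lossSlope y ≤ 1 := by
  rw [lossSlope, ← div_eq_mul_inv, div_le_one (by positivity)]
  linarith [Real.add_one_le_exp y]

lemma hasDerivAt_loss (y : ℝ) : HasDerivAt loss (-lossSlope y) y := by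
  have h1 : HasDerivAt (fun y : ℝ => 1 + Real.exp (-y)) (Real.exp (-y) * -1) y :=
    ((hasDerivAt_neg y).exp).const_add 1
  have h2 := h1.log (by positivity)
  refine h2.congr_deriv ?_
  rw [lossSlope, Real.exp_neg]
  field_simp
  ring

lemma continuous_loss : Continuous loss :=
  continuous_iff_continuousAt.2 fun y => (hasDerivAt_loss y).continuousAt

lemma continuous_lossSlope : Continuous lossSlope := by
  unfold lossSlope
  exact (by fun_prop : Continuous fun y : ℝ => 1 + Real.exp y).inv₀ fun y => by positivity

lemma loss_nonneg (y : ℝ) : 0 ≤ loss y :=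
  Real.log_nonneg (by linarith [Real.exp_pos (-y)])

lemma neg_le_loss (y : ℝ) : -y ≤ loss y := by
  rw [loss, Real.le_log_iff_exp_le (by positivity)]
  linarith

lemma loss_le_one {y : ℝ} (hy : 0 ≤ y) : loss y ≤ 1 := by
  rw [loss]
  have h1 : Real.exp (-y) ≤ 1 := Real.exp_le_one_iff.2 (by linarith)
  linarith [Real.log_le_sub_one_of_pos (by positivity : 0 < 1 + Real.exp (-y))]

lemma loss_le (y : ℝ) : loss y ≤ 1 + |y| := by
  rw [loss, Real.log_le_iff_le_exp (by positivity)]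
  have h1 : Real.exp (-y) ≤ Real.exp |y| := Real.exp_le_exp.2 (neg_le_abs y)
  have h2 : 1 ≤ Real.exp |y| := Real.one_le_exp (abs_nonneg y)
  have h3 : (2 : ℝ) ≤ Real.exp 1 := by linarith [Real.add_one_le_exp 1]
  rw [Real.exp_add]
  nlinarith

lemma continuous_penLoss (μ : ℝ) : Continuous (penLoss μ) := by
  unfold penLoss
  exact continuous_loss.add (continuous_loss.comp (by fun_prop))

lemma continuous_penSlope (μ : ℝ) : Continuous (penSlope μ) := by
  unfold penSlope
  exact continuous_lossSlope.add (continuous_const.mul (continuous_lossSlope.comp (by fun_prop)))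

lemma hasDerivAt_penLoss (μ x : ℝ) : HasDerivAt (penLoss μ) (-penSlope μ x) x := by
  have h1 : HasDerivAt (fun x : ℝ => μ * (x + 1)) (μ * 1) x :=
    ((hasDerivAt_id x).add_const 1).const_mul μ
  have h2 := (hasDerivAt_loss x).add ((hasDerivAt_loss (μ * (x + 1))).comp x h1)
  refine h2.congr_deriv ?_
  rw [penSlope]
  ring

lemma penLoss_nonneg (μ x : ℝ) : 0 ≤ penLoss μ x := add_nonneg (loss_nonneg _) (loss_nonneg _)

lemma penLoss_le {μ : ℝ} (hμ : 0 ≤ μ) (x : ℝ) : penLoss μ x ≤ (2 + μ) + (1 + μ) * |x| := by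
  have h1 := loss_le x
  have h2 := loss_le (μ * (x + 1))
  rw [abs_mul, abs_of_nonneg hμ] at h2
  have h3 : |x + 1| ≤ |x| + 1 := by simpa using abs_add_le x 1
  rw [penLoss]
  nlinarith [mul_le_mul_of_nonneg_left h3 hμ]

lemma penLoss_zero_le {μ : ℝ} (hμ : 0 ≤ μ) : penLoss μ 0 ≤ 2 := by
  have h1 := loss_le_one le_rfl
  have h2 : loss (μ * (0 + 1)) ≤ 1 := loss_le_one (by simpa using hμ)
  rw [penLoss]
  linarith

lemma mul_le_penLoss {μ : ℝ} (hμ : 0 ≤ μ) (x : ℝ) : μ * max 0 (-(x + 1)) ≤ penLoss μ x := by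
  rw [mul_max_of_nonneg _ _ hμ]
  refine max_le ?_ ?_
  · simpa using penLoss_nonneg μ x
  · rw [penLoss]
    have := neg_le_loss (μ * (x + 1))
    linarith [loss_nonneg x]

lemma lossSlope_le_penSlope {μ : ℝ} (hμ : 0 ≤ μ) (x : ℝ) : lossSlope x ≤ penSlope μ x :=
  le_add_of_nonneg_right (mul_nonneg hμ (lossSlope_pos _).le)

lemma penSlope_pos {μ : ℝ} (hμ : 0 ≤ μ) (x : ℝ) : 0 < penSlope μ x :=
  (lossSlope_pos x).trans_le (lossSlope_le_penSlope hμ x)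

lemma penSlope_le {μ : ℝ} (hμ : 0 ≤ μ) (x : ℝ) : penSlope μ x ≤ 1 + μ := by
  have h1 := lossSlope_le_one x
  have h2 := mul_le_mul_of_nonneg_left (lossSlope_le_one (μ * (x + 1))) hμ
  rw [penSlope]
  linarith

lemma penSlope_add_le {μ : ℝ} (hμ : 0 ≤ μ) (x : ℝ) :
    penSlope μ x + 2 * (penSlope μ x * x) ≤ 5 := by
  have h1 := lossSlope_le_one x
  have h2 := mul_lossSlope_le_one x
  have h3 := mul_lossSlope_le_one (μ * (x + 1))
  have h4 : 0 ≤ μ * lossSlope (μ * (x + 1)) := mul_nonneg hμ (lossSlope_pos _).le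
  rw [penSlope]
  nlinarith

lemma abs_penLoss_le {μ : ℝ} (hμ : 0 ≤ μ) (x : ℝ) :
    |penLoss μ x| ≤ (2 + μ) + (1 + μ) * |x| := by
  rw [abs_of_nonneg (penLoss_nonneg μ x)]
  exact penLoss_le hμ x

lemma convExp_eq_zero {Q : Measure Ω} {f : Ω → ℝ} (hf : Integrable f Q) (h0 : ∫ ω, f ω ∂Q = 0) :
    convExp Q f = 0 := by
  have h1 : ∫⁻ ω, ENNReal.ofReal (-f ω) ∂Q ≠ ∞ := hf.neg.lintegral_lt_top.ne
  rw [integral_eq_lintegral_pos_part_sub_lintegral_neg_part hf, sub_eq_zero,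
    ENNReal.toReal_eq_toReal_iff' hf.lintegral_lt_top.ne h1] at h0
  rw [convExp, h0]
  refine EReal.sub_self ?_ ?_ <;> simp [h1]

section Gain

variable {d : ℕ} {S0 : Fin d → ℝ}

section Pointwise

variable {α : Type*} {S1 : α → Fin d → ℝ}

lemma gain_add (H K : Fin d → ℝ) (ω : α) :
    gain (H + K) S0 S1 ω = gain H S0 S1 ω + gain K S0 S1 ω := by
  simp [gain, add_mul, Finset.sum_add_distrib]

lemma gain_smul (c : ℝ) (H : Fin d → ℝ) (ω : α) :
    gain (c • H) S0 S1 ω = c * gain H S0 S1 ω := by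
  simp [gain, mul_assoc, Finset.mul_sum]

lemma gain_zero (ω : α) : gain 0 S0 S1 ω = 0 := by simp [gain]

lemma gain_single (i : Fin d) (ω : α) : gain (Pi.single i 1) S0 S1 ω = S1 ω i - S0 i := by
  simp [gain, Pi.single_apply]

lemma continuous_gain (ω : α) : Continuous fun H : Fin d → ℝ => gain H S0 S1 ω := by
  unfold gain
  fun_prop

lemma abs_gain_le (H : Fin d → ℝ) (ω : α) :
    |gain H S0 S1 ω| ≤ ‖H‖ * ∑ i, |S1 ω i - S0 i| := by
  rw [gain, Finset.mul_sum]
  refine (Finset.abs_sum_le_sum_abs _ _).trans (Finset.sum_le_sum fun i _ => ?_)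
  rw [abs_mul]
  exact mul_le_mul_of_nonneg_right (norm_le_pi_norm H i) (abs_nonneg _)

end Pointwise

variable {S1 : Ω → Fin d → ℝ}

lemma measurable_gain (hS : ∀ i, Measurable fun ω => S1 ω i) (H : Fin d → ℝ) :
    Measurable (gain H S0 S1) := by
  unfold gain
  fun_prop

variable {ρ : Measure Ω}

lemma integrable_gain (hint : ∀ i, Integrable (fun ω => S1 ω i - S0 i) ρ) (H : Fin d → ℝ) :
    Integrable (gain H S0 S1) ρ := by
  unfold gain
  exact integrable_finsetSum _ fun i _ => (hint i).const_mul _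

lemma integrable_penSlope_mul {μ : ℝ} (hμ : 0 ≤ μ)
    (hint : ∀ i, Integrable (fun ω => S1 ω i - S0 i) ρ) (H : Fin d → ℝ)
    {f : Ω → ℝ} (hf : Integrable f ρ) :
    Integrable (fun ω => penSlope μ (gain H S0 S1 ω) * f ω) ρ := by
  refine hf.bdd_mul (c := 1 + μ)
    ((continuous_penSlope μ).comp_aestronglyMeasurable (integrable_gain hint H).aestronglyMeasurable)
    (ae_of_all _ fun ω => ?_)
  rw [Real.norm_eq_abs, abs_of_pos (penSlope_pos hμ _)]
  exact penSlope_le hμ _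

variable [IsFiniteMeasure ρ]

lemma integrable_comp_gain (hint : ∀ i, Integrable (fun ω => S1 ω i - S0 i) ρ)
    {φ : ℝ → ℝ} (hφ : Continuous φ) {a b : ℝ} (hb : ∀ x, |φ x| ≤ a + b * |x|)
    (H : Fin d → ℝ) : Integrable (fun ω => φ (gain H S0 S1 ω)) ρ := by
  have hi := integrable_gain hint H
  refine ((integrable_const a).add (hi.abs.const_mul b)).mono'
    (hφ.comp_aestronglyMeasurable hi.aestronglyMeasurable) (ae_of_all _ fun ω => hb _)

lemma continuous_integral_comp_gain (hint : ∀ i, Integrable (fun ω => S1 ω i - S0 i) ρ)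
    {φ : ℝ → ℝ} (hφ : Continuous φ) {a b : ℝ} (hb0 : 0 ≤ b) (hb : ∀ x, |φ x| ≤ a + b * |x|) :
    Continuous fun H : Fin d → ℝ => ∫ ω, φ (gain H S0 S1 ω) ∂ρ := by
  refine continuous_iff_continuousAt.2 fun H => ?_
  have hB : Integrable (fun ω => a + b * ((‖H‖ + 1) * ∑ i, |S1 ω i - S0 i|)) ρ :=
    (integrable_const a).add
      (((integrable_finsetSum _ fun i _ => (hint i).abs).const_mul (‖H‖ + 1)).const_mul b)
  refine continuousAt_of_dominated (bound := fun ω => a + b * ((‖H‖ + 1) * ∑ i, |S1 ω i - S0 i|))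
    (Eventually.of_forall fun K =>
      hφ.comp_aestronglyMeasurable (integrable_gain hint K).aestronglyMeasurable) ?_ hB
    (ae_of_all _ fun ω => (hφ.comp (continuous_gain ω)).continuousAt)
  have hnear : ∀ᶠ K : Fin d → ℝ in 𝓝 H, ‖K‖ < ‖H‖ + 1 :=
    continuous_norm.continuousAt.eventually_lt continuousAt_const (by simp)
  filter_upwards [hnear] with K hK
  refine ae_of_all _ fun ω => (hb _).trans ?_
  gcongr
  exact (abs_gain_le K ω).trans (by gcongr)

/-- First order condition for minimizers of the expected penalized loss. -/
lemma integral_penSlope_mul_eq_zero {μ : ℝ} (hμ : 0 ≤ μ)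
    (hint : ∀ i, Integrable (fun ω => S1 ω i - S0 i) ρ) {H : Fin d → ℝ}
    (hmin : ∀ K : Fin d → ℝ,
      ∫ ω, penLoss μ (gain H S0 S1 ω) ∂ρ ≤ ∫ ω, penLoss μ (gain K S0 S1 ω) ∂ρ)
    (V : Fin d → ℝ) :
    ∫ ω, penSlope μ (gain H S0 S1 ω) * gain V S0 S1 ω ∂ρ = 0 := by
  have hder := (hasDerivAt_integral_of_dominated_loc_of_deriv_le (μ := ρ) (𝕜 := ℝ)
    (F := fun t ω => penLoss μ (gain (H + t • V) S0 S1 ω))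
    (F' := fun t ω => -penSlope μ (gain (H + t • V) S0 S1 ω) * gain V S0 S1 ω)
    (x₀ := 0) (s := Set.univ) (bound := fun ω => (1 + μ) * |gain V S0 S1 ω|) univ_mem
    (Eventually.of_forall fun t => (continuous_penLoss μ).comp_aestronglyMeasurable
      (integrable_gain hint _).aestronglyMeasurable)
    (integrable_comp_gain hint (continuous_penLoss μ) (abs_penLoss_le hμ) _)
    (((continuous_penSlope μ).neg.comp_aestronglyMeasurable
      (integrable_gain hint _).aestronglyMeasurable).mul
      (integrable_gain hint V).aestronglyMeasurable)
    (ae_of_all _ fun ω t _ => by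
      rw [norm_mul, norm_neg, Real.norm_eq_abs, Real.norm_eq_abs,
        abs_of_pos (penSlope_pos hμ _)]
      gcongr
      exact penSlope_le hμ _)
    ((integrable_gain hint V).abs.const_mul _)
    (ae_of_all _ fun ω t _ => by
      have h1 : HasDerivAt (fun t : ℝ => gain (H + t • V) S0 S1 ω) (gain V S0 S1 ω) t := by
        simp only [gain_add, gain_smul]
        simpa using ((hasDerivAt_id t).mul_const (gain V S0 S1 ω)).const_add (gain H S0 S1 ω)
      exact (hasDerivAt_penLoss μ _).comp t h1)).2
  have hloc : IsLocalMin (fun t : ℝ => ∫ ω, penLoss μ (gain (H + t • V) S0 S1 ω) ∂ρ) 0 :=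
    Eventually.of_forall fun t => by simpa using hmin (H + t • V)
  have hzero := hloc.hasDerivAt_eq_zero hder
  simpa [integral_neg] using hzero

/-- A minimizer of the expected penalized loss induces a martingale measure with an explicit
lower bound on its density. -/
lemma exists_martingale_of_minimizer (hR0 : ρ ≠ 0) (hR2 : ρ.real Set.univ ≤ 2)
    {μ : ℝ} (hμ : 0 ≤ μ)
    (hint : ∀ i, Integrable (fun ω => S1 ω i - S0 i) ρ) {H : Fin d → ℝ}
    (hmin : ∀ K : Fin d → ℝ,
      ∫ ω, penLoss μ (gain H S0 S1 ω) ∂ρ ≤ ∫ ω, penLoss μ (gain K S0 S1 ω) ∂ρ) :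
    ∃ Q : Measure Ω, IsProbabilityMeasure Q ∧ Q ≪ ρ ∧
      (∀ i, Integrable (fun ω => S1 ω i - S0 i) Q ∧ ∫ ω, (S1 ω i - S0 i) ∂Q = 0) ∧
      ∀ (m : ℝ) (A : Set Ω), MeasurableSet A → (∀ ω ∈ A, gain H S0 S1 ω ≤ m) →
        lossSlope m * ρ.real A ≤ 10 * Q.real A := by
  set ψ : Ω → ℝ := fun ω => penSlope μ (gain H S0 S1 ω) with hψ
  have hψi : Integrable ψ ρ := by
    simpa using integrable_penSlope_mul hμ hint H (integrable_const (1 : ℝ))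
  have hψ0 : ∀ ω, 0 < ψ ω := fun ω => penSlope_pos hμ _
  set Z : ℝ := ∫ ω, ψ ω ∂ρ with hZ
  have hZpos : 0 < Z := by
    refine (integral_pos_iff_support_of_nonneg (fun ω => (hψ0 ω).le) hψi).2 ?_
    have : Function.support ψ = Set.univ := Set.eq_univ_of_forall fun ω => (hψ0 ω).ne'
    rw [this]
    exact Measure.measure_univ_pos.2 hR0
  have hZle : Z ≤ 10 := by
    have hX := integrable_penSlope_mul hμ hint H (integrable_gain hint H)
    have h1 : ∫ ω, (ψ ω + 2 * (ψ ω * gain H S0 S1 ω)) ∂ρ ≤ ∫ _, (5 : ℝ) ∂ρ :=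
      integral_mono (hψi.add (hX.const_mul 2)) (integrable_const _)
        fun ω => penSlope_add_le hμ _
    rw [integral_add hψi (hX.const_mul 2), integral_const_mul,
      integral_penSlope_mul_eq_zero hμ hint hmin H, integral_const, smul_eq_mul] at h1
    linarith
  have hψai : Integrable (fun ω => ψ ω / Z) ρ := hψi.div_const Z
  set q : Ω → ℝ≥0∞ := fun ω => ENNReal.ofReal (ψ ω / Z) with hq
  have hqm : AEMeasurable q ρ := hψai.aestronglyMeasurable.aemeasurable.ennreal_ofReal
  have hqlt : ∀ᵐ ω ∂ρ, q ω < ∞ := ae_of_all _ fun ω => ENNReal.ofReal_lt_top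
  have hqr : ∀ ω, (q ω).toReal = ψ ω / Z := fun ω =>
    ENNReal.toReal_ofReal (div_nonneg (hψ0 ω).le hZpos.le)
  have hQA : ∀ A, MeasurableSet A →
      ρ.withDensity q A = ENNReal.ofReal (∫ ω in A, ψ ω / Z ∂ρ) := fun A hA => by
    rw [withDensity_apply _ hA, ofReal_integral_eq_lintegral_ofReal hψai.restrict
      (ae_of_all _ fun ω => div_nonneg (hψ0 ω).le hZpos.le)]
  refine ⟨ρ.withDensity q, ⟨?_⟩, withDensity_absolutelyContinuous ρ q, fun i => ⟨?_, ?_⟩, ?_⟩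
  · rw [hQA _ MeasurableSet.univ, setIntegral_univ, integral_div, ← hZ, div_self hZpos.ne',
      ENNReal.ofReal_one]
  · rw [integrable_withDensity_iff_integrable_smul₀' hqm hqlt]
    simp only [hqr, smul_eq_mul]
    refine ((integrable_penSlope_mul hμ hint H (hint i)).div_const Z).congr
      (ae_of_all _ fun ω => ?_)
    simp only [hψ]
    ring
  · rw [integral_withDensity_eq_integral_toReal_smul₀ hqm hqlt]
    have h1 := integral_penSlope_mul_eq_zero hμ hint hmin (Pi.single i 1)
    simp only [gain_single] at h1
    have h2 : ∀ ω, (q ω).toReal • (S1 ω i - S0 i)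
        = Z⁻¹ * (penSlope μ (gain H S0 S1 ω) * (S1 ω i - S0 i)) := fun ω => by
      rw [hqr, smul_eq_mul, hψ]
      ring
    simp only [h2]
    rw [integral_const_mul, h1, mul_zero]
  · intro m A hA hAm
    have hnn : 0 ≤ ∫ ω in A, ψ ω / Z ∂ρ :=
      integral_nonneg fun ω => div_nonneg (hψ0 ω).le hZpos.le
    rw [measureReal_def (ρ.withDensity q), hQA A hA, ENNReal.toReal_ofReal hnn]
    have h1 : ∫ _ in A, lossSlope m / 10 ∂ρ ≤ ∫ ω in A, ψ ω / Z ∂ρ := by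
      refine setIntegral_mono_on (integrable_const _).integrableOn hψai.integrableOn hA
        fun ω hω => ?_
      have h2 : lossSlope m ≤ ψ ω :=
        (lossSlope_anti (hAm ω hω)).trans (lossSlope_le_penSlope hμ _)
      exact div_le_div₀ (hψ0 ω).le h2 hZpos hZle
    rw [setIntegral_const, smul_eq_mul] at h1
    linarith

/-- Existence of a minimizer of the expected penalized loss which avoids a given closed set, for
a strong enough penalty. -/
lemma exists_minimizer_notMem (hR2 : ρ.real Set.univ ≤ 2)
    (hint : ∀ i, Integrable (fun ω => S1 ω i - S0 i) ρ) {W : Submodule ℝ (Fin d → ℝ)}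
    (hW : ∀ V : Fin d → ℝ, ∃ K ∈ W, ∀ᵐ ω ∂ρ, gain V S0 S1 ω = gain K S0 S1 ω)
    {T : Set (Fin d → ℝ)} (hT : IsClosed T) {B : ℝ} (hB : 0 ≤ B)
    (hsphere : ∀ H ∈ W, ‖H‖ = B → ¬ ∀ᵐ ω ∂ρ, -1 ≤ gain H S0 S1 ω)
    (hTW : ∀ H ∈ W, H ∈ T → ‖H‖ ≤ B → ¬ ∀ᵐ ω ∂ρ, -1 ≤ gain H S0 S1 ω) :
    ∃ μ : ℝ, 0 ≤ μ ∧ ∃ H ∉ T, ∀ K : Fin d → ℝ,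
      ∫ ω, penLoss μ (gain H S0 S1 ω) ∂ρ ≤ ∫ ω, penLoss μ (gain K S0 S1 ω) ∂ρ := by
  have hsc : Continuous fun x : ℝ => max 0 (-(x + 1)) := by fun_prop
  have hsb : ∀ x : ℝ, |max 0 (-(x + 1))| ≤ 1 + 1 * |x| := fun x => by
    rw [abs_of_nonneg (le_max_left _ _)]
    exact max_le (by positivity) (by linarith [neg_le_abs x])
  set f : (Fin d → ℝ) → ℝ := fun H => ∫ ω, max 0 (-(gain H S0 S1 ω + 1)) ∂ρ with hf
  have hfi : ∀ H : Fin d → ℝ, Integrable (fun ω => max 0 (-(gain H S0 S1 ω + 1))) ρ :=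
    fun H => integrable_comp_gain hint hsc hsb H
  have hfc : Continuous f := continuous_integral_comp_gain hint hsc zero_le_one hsb
  have hfpos : ∀ H, (¬ ∀ᵐ ω ∂ρ, -1 ≤ gain H S0 S1 ω) → 0 < f H := fun H hH => by
    refine lt_of_le_of_ne (integral_nonneg fun ω => le_max_left _ _) fun h0 => hH ?_
    have := (integral_eq_zero_iff_of_nonneg (fun ω => le_max_left _ _) (hfi H)).1 h0.symm
    filter_upwards [this] with ω hω
    have h1 : -(gain H S0 S1 ω + 1) ≤ 0 := (le_max_right _ _).trans hω.le
    linarith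
  have hWc : IsClosed (W : Set (Fin d → ℝ)) := W.closed_of_finiteDimensional
  obtain ⟨c₁, hc₁, hc₁'⟩ := ((isCompact_sphere (0 : Fin d → ℝ) B).inter_right
    hWc).exists_forall_le' hfc.continuousOn (a := 0)
    fun H hH => hfpos H (hsphere H hH.2 (by simpa using hH.1))
  obtain ⟨c₂, hc₂, hc₂'⟩ := ((isCompact_closedBall (0 : Fin d → ℝ) B).inter_right
    (hWc.inter hT)).exists_forall_le' hfc.continuousOn (a := 0)
    fun H hH => hfpos H (hTW H hH.2.1 hH.2.2 (by simpa using hH.1))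
  have hc : 0 < min c₁ c₂ := lt_min hc₁ hc₂
  set c := min c₁ c₂ with hcdef
  have hout : ∀ H ∈ W, B ≤ ‖H‖ → c ≤ f H := fun H hHW hH => by
    rcases eq_or_ne ‖H‖ 0 with h0 | h0
    · exact (min_le_left _ _).trans (hc₁' H ⟨by simp; linarith [norm_nonneg H], hHW⟩)
    have hHpos : 0 < ‖H‖ := lt_of_le_of_ne (norm_nonneg H) h0.symm
    have h1 : c₁ ≤ f ((B / ‖H‖) • H) := by
      refine hc₁' _ ⟨?_, W.smul_mem _ hHW⟩
      rw [mem_sphere_zero_iff_norm, norm_smul, Real.norm_eq_abs, abs_of_nonneg (by positivity),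
        div_mul_cancel₀ _ h0]
    refine (min_le_left _ _).trans (h1.trans (integral_mono (hfi _) (hfi _) fun ω => ?_))
    have h2 : B / ‖H‖ ≤ 1 := (div_le_one hHpos).2 hH
    have h3 : 0 ≤ B / ‖H‖ := by positivity
    simp only [gain_smul]
    refine max_le (le_max_left _ _) ?_
    rcases le_total 0 (gain H S0 S1 ω) with h4 | h4
    · exact le_max_of_le_left (by nlinarith)
    · exact le_max_of_le_right (by nlinarith)
  set μ : ℝ := 5 / c with hμdef
  have hμ : 0 ≤ μ := by positivity
  have hFi : ∀ H : Fin d → ℝ, Integrable (fun ω => penLoss μ (gain H S0 S1 ω)) ρ :=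
    fun H => integrable_comp_gain hint (continuous_penLoss μ) (abs_penLoss_le hμ) H
  have hFc : Continuous fun H : Fin d → ℝ => ∫ ω, penLoss μ (gain H S0 S1 ω) ∂ρ :=
    continuous_integral_comp_gain hint (continuous_penLoss μ) (by linarith) (abs_penLoss_le hμ)
  have hF0 : ∫ ω, penLoss μ (gain (0 : Fin d → ℝ) S0 S1 ω) ∂ρ ≤ 4 := by
    simp only [gain_zero, integral_const, smul_eq_mul]
    nlinarith [penLoss_zero_le hμ, penLoss_nonneg μ 0, measureReal_nonneg (μ := ρ) (s := Set.univ)]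
  have hlarge : ∀ H : Fin d → ℝ, c ≤ f H → 5 ≤ ∫ ω, penLoss μ (gain H S0 S1 ω) ∂ρ := fun H hH =>
    calc (5 : ℝ) = μ * c := by rw [hμdef, div_mul_cancel₀ _ hc.ne']
      _ ≤ μ * f H := mul_le_mul_of_nonneg_left hH hμ
      _ = ∫ ω, μ * max 0 (-(gain H S0 S1 ω + 1)) ∂ρ := (integral_const_mul _ _).symm
      _ ≤ _ := integral_mono ((hfi H).const_mul μ) (hFi H) fun ω => mul_le_penLoss hμ _
  obtain ⟨H, ⟨hHB, hHW⟩, hHmin⟩ := ((isCompact_closedBall (0 : Fin d → ℝ) B).inter_right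
    hWc).exists_isMinOn ⟨0, by simpa using hB, W.zero_mem⟩ hFc.continuousOn
  have hH4 : ∫ ω, penLoss μ (gain H S0 S1 ω) ∂ρ ≤ 4 :=
    (show _ ≤ _ from hHmin ⟨by simpa using hB, W.zero_mem⟩).trans hF0
  refine ⟨μ, hμ, H, fun hHT => ?_, fun V => ?_⟩
  · have := hlarge H ((min_le_right _ _).trans (hc₂' H ⟨hHB, hHW, hHT⟩))
    linarith
  · obtain ⟨K, hKW, hK⟩ := hW V
    have hVK : ∫ ω, penLoss μ (gain V S0 S1 ω) ∂ρ = ∫ ω, penLoss μ (gain K S0 S1 ω) ∂ρ :=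
      integral_congr_ae (hK.mono fun ω hω => by simp only [hω])
    rw [hVK]
    rcases le_total ‖K‖ B with h | h
    · exact hHmin ⟨by simpa using h, hKW⟩
    · linarith [hlarge K (hout K hKW h)]

/-- A finite reference measure with integrable price increments, equivalent to `P'` and dominating
`P` up to a small error. -/
lemma exists_reference_measure (hS : ∀ i, Measurable fun ω => S1 ω i) {P P' : Measure Ω}
    [IsProbabilityMeasure P] [IsProbabilityMeasure P'] (hPP : P ≪ P') {ε : ℝ} (hε : 0 < ε) :
    ∃ ν : Measure Ω, IsFiniteMeasure ν ∧ ν.real Set.univ ≤ 2 ∧ ν ≪ P' ∧ P' ≪ ν ∧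
      (∀ i, Integrable (fun ω => S1 ω i - S0 i) ν) ∧
      ∀ A, MeasurableSet A → P.real A ≤ ε + ν.real A := by
  set Y : Ω → ℝ := fun ω => ∑ i, |S1 ω i - S0 i| with hY
  have hYm : Measurable Y := Finset.measurable_fun_sum _ fun i _ =>
    ((hS i).sub_const (S0 i)).abs
  have hY0 : ∀ ω, 0 ≤ Y ω := fun ω => Finset.sum_nonneg fun i _ => abs_nonneg _
  have hYi : ∀ ω i, |S1 ω i - S0 i| ≤ Y ω := fun ω i =>
    Finset.single_le_sum (f := fun i => |S1 ω i - S0 i|) (fun j _ => abs_nonneg _)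
      (Finset.mem_univ i)
  have hm : ∀ i, Measurable fun ω => S1 ω i - S0 i := fun i => (hS i).sub_const _
  obtain ⟨r, hr⟩ : ∃ r : ℕ, P.real {ω | (r : ℝ) < Y ω} < ε := by
    have h1 : Tendsto (fun n : ℕ => P {ω | (n : ℝ) < Y ω}) atTop
        (𝓝 (P (⋂ n : ℕ, {ω | (n : ℝ) < Y ω}))) :=
      tendsto_measure_iInter_atTop
        (fun n => (measurableSet_lt measurable_const hYm).nullMeasurableSet)
        (fun m n hmn ω (hω : (n : ℝ) < Y ω) => (Nat.cast_le.2 hmn).trans_lt hω) ⟨0, measure_ne_top _ _⟩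
    have h2 : (⋂ n : ℕ, {ω | (n : ℝ) < Y ω}) = ∅ := by
      refine Set.eq_empty_of_forall_notMem fun ω hω => ?_
      obtain ⟨n, hn⟩ := exists_nat_ge (Y ω)
      exact absurd (Set.mem_iInter.1 hω n) (not_lt.2 hn)
    rw [h2, measure_empty] at h1
    obtain ⟨r, hr⟩ := (h1.eventually_lt_const (ENNReal.ofReal_pos.2 hε)).exists
    exact ⟨r, by
      rw [measureReal_def]
      exact (ENNReal.lt_ofReal_iff_toReal_lt (measure_ne_top _ _)).1 hr⟩
  set G : Set Ω := {ω | Y ω ≤ r} with hG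
  have hGm : MeasurableSet G := measurableSet_le hYm measurable_const
  set w : Ω → ℝ≥0∞ := fun ω => ENNReal.ofReal (1 + Y ω)⁻¹ with hw
  have hwm : Measurable w := (hYm.const_add 1).inv.ennreal_ofReal
  have hw1 : ∀ ω, w ω ≤ 1 := fun ω => by
    rw [hw, ← ENNReal.ofReal_one]
    exact ENNReal.ofReal_le_ofReal (inv_le_one_of_one_le₀ (by linarith [hY0 ω]))
  have hwU : P'.withDensity w Set.univ ≤ 1 := by
    rw [withDensity_apply _ MeasurableSet.univ, setLIntegral_univ]
    exact (lintegral_mono hw1).trans (by simp)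
  have hU : (P.restrict G + P'.withDensity w) Set.univ ≤ 2 := by
    rw [Measure.add_apply, ← one_add_one_eq_two]
    exact add_le_add ((Measure.restrict_apply_le _ _).trans prob_le_one) hwU
  have hfin : IsFiniteMeasure (P.restrict G + P'.withDensity w) :=
    ⟨hU.trans_lt (by simp)⟩
  refine ⟨P.restrict G + P'.withDensity w, hfin, ?_, ?_, ?_, fun i => ?_, fun A hA => ?_⟩
  · exact ENNReal.toReal_le_of_le_ofReal (by norm_num) (by simpa using hU)
  · exact Measure.AbsolutelyContinuous.add_left
      (Measure.restrict_le_self.absolutelyContinuous.trans hPP)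
      (withDensity_absolutelyContinuous P' w)
  · refine (withDensity_absolutelyContinuous' hwm.aemeasurable (ae_of_all _ fun ω => ?_)).trans
      (Measure.absolutelyContinuous_of_le (Measure.le_add_left le_rfl))
    exact (ENNReal.ofReal_pos.2 (inv_pos.2 (by linarith [hY0 ω]))).ne'
  · refine Integrable.add_measure ?_ ?_
    · refine Integrable.of_bound (hm i).aestronglyMeasurable (r : ℝ) ?_
      filter_upwards [ae_restrict_mem hGm] with ω hω
      exact (hYi ω i).trans hω
    · rw [integrable_withDensity_iff_integrable_smul' hwm
        (ae_of_all _ fun ω => ENNReal.ofReal_lt_top)]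
      refine Integrable.of_bound
        (hwm.ennreal_toReal.smul (hm i)).aestronglyMeasurable 1 (ae_of_all _ fun ω => ?_)
      have hpos : 0 < 1 + Y ω := by linarith [hY0 ω]
      rw [hw, norm_smul, Real.norm_eq_abs, Real.norm_eq_abs,
        ENNReal.toReal_ofReal (inv_pos.2 hpos).le, abs_of_pos (inv_pos.2 hpos),
        inv_mul_le_one₀ hpos]
      linarith [hYi ω i]
  · have h1 : P.real A ≤ P.real (A ∩ G) + P.real Gᶜ := by
      refine (measureReal_mono (s₂ := (A ∩ G) ∪ Gᶜ) fun ω hω => ?_).trans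
        (measureReal_union_le _ _)
      by_cases h : ω ∈ G
      · exact Or.inl ⟨hω, h⟩
      · exact Or.inr h
    have h2 : P.real Gᶜ < ε := by
      convert hr using 2
      ext ω
      simp [hG]
    have h3 : P.real (A ∩ G) ≤ (P.restrict G + P'.withDensity w).real A := by
      refine ENNReal.toReal_mono (measure_ne_top _ _) ?_
      rw [Measure.add_apply, Measure.restrict_apply hA]
      exact le_self_add
    linarith

end Gain

lemma QS.ae {Ps : Set (Measure Ω)} {p : Ω → Prop} (h : QS Ps p) {P : Measure Ω} (hP : P ∈ Ps) :
    ∀ᵐ ω ∂P, p ω := by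
  obtain ⟨N, -, hN, hp⟩ := h
  exact ae_iff.2 (measure_mono_null (fun ω hω => by_contra fun hn => hω (hp ω hn)) (hN P hP))

lemma qs_of_forall_ae {Ps : Set (Measure Ω)} {p : Ω → Prop} (hm : MeasurableSet {ω | p ω})
    (h : ∀ P ∈ Ps, ∀ᵐ ω ∂P, p ω) : QS Ps p :=
  ⟨{ω | p ω}ᶜ, hm.compl, fun P hP => ae_iff.1 (h P hP), fun _ hω => not_not.1 hω⟩

lemma absolutelyContinuous_half_add_half (P₁ P₂ : Measure Ω) :
    P₁ ≪ (2⁻¹ : ℝ≥0∞) • P₁ + (1 - 2⁻¹ : ℝ≥0∞) • P₂ ∧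
      P₂ ≪ (2⁻¹ : ℝ≥0∞) • P₁ + (1 - 2⁻¹ : ℝ≥0∞) • P₂ := by
  rw [ENNReal.one_sub_inv_two]
  exact ⟨(Measure.absolutelyContinuous_smul (by simp)).trans
      (Measure.absolutelyContinuous_of_le (Measure.le_add_right le_rfl)),
    (Measure.absolutelyContinuous_smul (by simp)).trans
      (Measure.absolutelyContinuous_of_le (Measure.le_add_left le_rfl))⟩

lemma ConvexProbFamily.exists_dominating (C : ConvexProbFamily Ω) {P₁ P₂ : Measure Ω}
    (h₁ : P₁ ∈ C.sets) (h₂ : P₂ ∈ C.sets) : ∃ P ∈ C.sets, P₁ ≪ P ∧ P₂ ≪ P :=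
  ⟨_, C.convex P₁ h₁ P₂ h₂ 2⁻¹ (by simp [ENNReal.inv_le_one]),
    absolutelyContinuous_half_add_half P₁ P₂⟩

/-- A compact set covered by open sets which increase along domination of measures is covered by
a single one of them. -/
lemma ConvexProbFamily.exists_subset_of_isCompact (C : ConvexProbFamily Ω) {X : Type*}
    [TopologicalSpace X] {K : Set X} (hK : IsCompact K) (U : Measure Ω → ℕ → Set X)
    (hU : ∀ P n, IsOpen (U P n))
    (hmono : ∀ P P' : Measure Ω, P ≪ P' → ∀ n n', n ≤ n' → U P n ⊆ U P' n')
    (hKU : ∀ x ∈ K, ∃ P ∈ C.sets, ∃ n, x ∈ U P n) :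
    ∃ P ∈ C.sets, ∃ n, K ⊆ U P n := by
  have : Nonempty (C.sets × ℕ) := ⟨⟨C.nonempty.some, C.nonempty.some_mem⟩, 0⟩
  obtain ⟨i, hi⟩ := hK.elim_directed_cover (fun i : C.sets × ℕ => U i.1 i.2) (fun i => hU _ _)
    (fun x hx => by
      obtain ⟨P, hP, n, hn⟩ := hKU x hx
      exact Set.mem_iUnion.2 ⟨⟨⟨P, hP⟩, n⟩, hn⟩)
    (fun i j => by
      obtain ⟨P, hP, h₁, h₂⟩ := C.exists_dominating i.1.2 j.1.2
      exact ⟨⟨⟨P, hP⟩, max i.2 j.2⟩, hmono _ _ h₁ _ _ (le_max_left _ _),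
        hmono _ _ h₂ _ _ (le_max_right _ _)⟩)
  exact ⟨i.1, i.1.2, i.2, hi⟩

section SmallMarket

variable {d : ℕ} {S0 : Fin d → ℝ} {S1 : Ω → Fin d → ℝ}

lemma isClosed_setOf_ae_le_gain (P : Measure Ω) (a : ℝ) :
    IsClosed {H : Fin d → ℝ | ∀ᵐ ω ∂P, a ≤ gain H S0 S1 ω} := by
  refine IsSeqClosed.isClosed fun H K hH hHK => ?_
  filter_upwards [ae_all_iff.2 hH] with ω hω
  exact ge_of_tendsto' (((continuous_gain ω).tendsto K).comp hHK) hω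

/-- A linear complement of the strategies with zero gain. -/
lemma exists_complement_null_strategies (Ps : Set (Measure Ω)) :
    ∃ W : Submodule ℝ (Fin d → ℝ),
      (∀ V : Fin d → ℝ, ∃ K ∈ W, QS Ps fun ω => gain V S0 S1 ω = gain K S0 S1 ω) ∧
      ∀ H ∈ W, (QS Ps fun ω => gain H S0 S1 ω = 0) → H = 0 := by
  let N : Submodule ℝ (Fin d → ℝ) :=
    { carrier := {H | QS Ps fun ω => gain H S0 S1 ω = 0}
      zero_mem' := ⟨∅, MeasurableSet.empty, fun P _ => measure_empty, fun ω _ => gain_zero ω⟩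
      add_mem' := by
        rintro H K ⟨N₁, hN₁, h₁, h₁'⟩ ⟨N₂, hN₂, h₂, h₂'⟩
        refine ⟨N₁ ∪ N₂, hN₁.union hN₂,
          fun P hP => measure_union_null (h₁ P hP) (h₂ P hP), fun ω hω => ?_⟩
        have e₁ : gain H S0 S1 ω = 0 := h₁' ω fun h => hω (Or.inl h)
        have e₂ : gain K S0 S1 ω = 0 := h₂' ω fun h => hω (Or.inr h)
        show gain (H + K) S0 S1 ω = 0
        rw [gain_add, e₁, e₂, add_zero]
      smul_mem' := by
        rintro c H ⟨N₁, hN₁, h₁, h₁'⟩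
        refine ⟨N₁, hN₁, h₁, fun ω hω => ?_⟩
        have e₁ : gain H S0 S1 ω = 0 := h₁' ω hω
        show gain (c • H) S0 S1 ω = 0
        rw [gain_smul, e₁, mul_zero] }
  obtain ⟨W, hW⟩ := Submodule.exists_isCompl N
  refine ⟨W, fun V => ?_, fun H hH hH0 => Submodule.disjoint_def.1 hW.disjoint H hH0 hH⟩
  obtain ⟨L, hL, K, hK, rfl⟩ := Submodule.mem_sup.1
    (hW.codisjoint.eq_top ▸ Submodule.mem_top : V ∈ N ⊔ W)
  obtain ⟨N₁, hN₁, h₁, h₁'⟩ := hL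
  refine ⟨K, hK, N₁, hN₁, h₁, fun ω hω => ?_⟩
  have e₁ : gain L S0 S1 ω = 0 := h₁' ω hω
  show gain (L + K) S0 S1 ω = gain K S0 S1 ω
  rw [gain_add, e₁, zero_add]

/-- Selection of a single measure from the uncertainty set which detects all large strategies and
all strategies from a given closed set of non-admissible ones. -/
lemma exists_detecting_measure (C : ConvexProbFamily Ω) (hS : ∀ i, Measurable fun ω => S1 ω i)
    (hNA : NAcond C.sets S0 S1) {P : Measure Ω} (hP : P ∈ C.sets) {W : Submodule ℝ (Fin d → ℝ)}
    (hW : ∀ H ∈ W, (QS C.sets fun ω => gain H S0 S1 ω = 0) → H = 0)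
    {T : Set (Fin d → ℝ)} (hT : IsClosed T)
    (hTQ : ∀ H ∈ T, ¬ QS C.sets fun ω => -1 ≤ gain H S0 S1 ω) :
    ∃ P' ∈ C.sets, P ≪ P' ∧ ∃ B : ℝ, 0 ≤ B ∧
      (∀ H ∈ W, ‖H‖ = B → ¬ ∀ᵐ ω ∂P', -1 ≤ gain H S0 S1 ω) ∧
      ∀ H ∈ W, H ∈ T → ‖H‖ ≤ B → ¬ ∀ᵐ ω ∂P', -1 ≤ gain H S0 S1 ω := by
  have hWc : IsClosed (W : Set (Fin d → ℝ)) := W.closed_of_finiteDimensional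
  obtain ⟨P₁, hP₁, n, hn⟩ := C.exists_subset_of_isCompact
    ((isCompact_sphere (0 : Fin d → ℝ) 1).inter_right hWc)
    (fun P n => {H | ¬ ∀ᵐ ω ∂P, -1 ≤ gain (((n : ℝ) + 1) • H) S0 S1 ω})
    (fun P n => ((isClosed_setOf_ae_le_gain P (-1)).preimage
      (continuous_const_smul ((n : ℝ) + 1))).isOpen_compl)
    (fun Q Q' hQ k k' hk H hH h => hH (by
      filter_upwards [hQ.ae_le h] with ω hω
      rw [gain_smul] at hω ⊢
      have hk' : (k : ℝ) ≤ k' := Nat.cast_le.2 hk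
      have hk0 : (0 : ℝ) ≤ k := Nat.cast_nonneg k
      rcases le_total 0 (gain H S0 S1 ω) with h0 | h0
      · nlinarith
      · nlinarith))
    (fun H hH => by
      by_contra hcon
      have hqs : QS C.sets fun ω => 0 ≤ gain H S0 S1 ω := by
        refine qs_of_forall_ae (measurableSet_le measurable_const (measurable_gain hS H))
          fun Q hQ => ?_
        have hall : ∀ᵐ ω ∂Q, ∀ k : ℕ, -1 ≤ gain (((k : ℝ) + 1) • H) S0 S1 ω :=
          ae_all_iff.2 fun k => by_contra fun h => hcon ⟨Q, hQ, k, h⟩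
        filter_upwards [hall] with ω hω
        by_contra! hneg
        obtain ⟨k, hk⟩ := exists_nat_gt (1 / -gain H S0 S1 ω)
        have h1 := hω k
        rw [div_lt_iff₀ (by linarith)] at hk
        rw [gain_smul] at h1
        linarith
      have hH0 := hW H hH.2 (hNA H hqs)
      have hH1 : ‖H‖ = 1 := mem_sphere_zero_iff_norm.1 hH.1
      simp [hH0] at hH1)
  obtain ⟨P₂, hP₂, -, h₂⟩ := C.exists_subset_of_isCompact
    ((isCompact_closedBall (0 : Fin d → ℝ) (n + 1)).inter_right hT)
    (fun P _ => {H | ¬ ∀ᵐ ω ∂P, -1 ≤ gain H S0 S1 ω})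
    (fun P _ => (isClosed_setOf_ae_le_gain P (-1)).isOpen_compl)
    (fun Q Q' hQ _ _ _ H hH h => hH (hQ.ae_le h))
    (fun H hH => by
      by_contra hcon
      exact hTQ H hH.2 (qs_of_forall_ae
        (measurableSet_le measurable_const (measurable_gain hS H))
        fun Q hQ => by_contra fun h => hcon ⟨Q, hQ, 0, h⟩))
  obtain ⟨P₃, hP₃, h₁₃, h₂₃⟩ := C.exists_dominating hP₁ hP₂
  obtain ⟨P', hP', hPP', h₃⟩ := C.exists_dominating hP hP₃
  have hn' : (0 : ℝ) < n + 1 := n.cast_add_one_pos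
  refine ⟨P', hP', hPP', n + 1, hn'.le, fun H hHW hHn h => ?_, fun H hHW hHT hHn h => ?_⟩
  · have hmem : ((n : ℝ) + 1)⁻¹ • H ∈ Metric.sphere (0 : Fin d → ℝ) 1 ∩ W := by
      refine ⟨?_, W.smul_mem _ hHW⟩
      rw [mem_sphere_zero_iff_norm, norm_smul, hHn, Real.norm_eq_abs,
        abs_of_pos (inv_pos.2 hn'), inv_mul_cancel₀ hn'.ne']
    refine hn hmem ?_
    rw [smul_inv_smul₀ hn'.ne']
    exact (h₁₃.trans h₃).ae_le h
  · exact h₂ ⟨by simpa using hHn, hHT⟩ ((h₂₃.trans h₃).ae_le h)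

lemma exists_isClosed_forall_notMem_measureReal_lt (hS : ∀ i, Measurable fun ω => S1 ω i) {P : Measure Ω}
    [IsProbabilityMeasure P] (m ε : ℝ) :
    ∃ T : Set (Fin d → ℝ), IsClosed T ∧
      (∀ H ∈ T, ε ≤ P.real {ω | m ≤ gain H S0 S1 ω}) ∧
      ∀ H ∉ T, P.real {ω | m + 1 < gain H S0 S1 ω} < ε := by
  set χ : ℝ → ℝ := fun x => max 0 (min 1 (x - m)) with hχ
  have hχc : Continuous χ := by fun_prop
  have hχ0 : ∀ x, 0 ≤ χ x := fun x => le_max_left _ _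
  have hχ1 : ∀ x, χ x ≤ 1 := fun x => max_le zero_le_one (min_le_left _ _)
  have hm : ∀ H : Fin d → ℝ, Measurable fun ω => χ (gain H S0 S1 ω) := fun H =>
    hχc.measurable.comp (measurable_gain hS H)
  have hb : ∀ H : Fin d → ℝ, ∀ᵐ ω ∂P, ‖χ (gain H S0 S1 ω)‖ ≤ 1 := fun H => ae_of_all _ fun ω => by
    rw [Real.norm_eq_abs, abs_of_nonneg (hχ0 _)]
    exact hχ1 _
  have hi : ∀ H : Fin d → ℝ, Integrable (fun ω => χ (gain H S0 S1 ω)) P := fun H =>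
    Integrable.of_bound (hm H).aestronglyMeasurable 1 (hb H)
  have hc : Continuous fun H : Fin d → ℝ => ∫ ω, χ (gain H S0 S1 ω) ∂P :=
    continuous_of_dominated (fun H => (hm H).aestronglyMeasurable) hb (integrable_const 1)
      (ae_of_all _ fun ω => hχc.comp (continuous_gain ω))
  refine ⟨{H | ε ≤ ∫ ω, χ (gain H S0 S1 ω) ∂P}, isClosed_le continuous_const hc,
    fun H hH => le_trans hH ?_, fun H hH => lt_of_le_of_lt ?_ (not_le.1 hH)⟩
  · have hms : MeasurableSet {ω | m ≤ gain H S0 S1 ω} :=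
      measurableSet_le measurable_const (measurable_gain hS H)
    rw [← integral_indicator_one hms]
    refine integral_mono (hi H) ((integrable_const 1).indicator hms) fun ω => ?_
    by_cases h : m ≤ gain H S0 S1 ω
    · simpa [Set.indicator, h] using hχ1 _
    · have : min 1 (gain H S0 S1 ω - m) ≤ 0 := (min_le_right _ _).trans (by linarith)
      simp [Set.indicator, h, hχ, this]
  · have hms : MeasurableSet {ω | m + 1 < gain H S0 S1 ω} :=
      measurableSet_lt measurable_const (measurable_gain hS H)
    rw [← integral_indicator_one hms]
    refine integral_mono ((integrable_const 1).indicator hms) (hi H) fun ω => ?_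
    by_cases h : m + 1 < gain H S0 S1 ω
    · have : (1 : ℝ) ≤ gain H S0 S1 ω - m := by linarith
      simp [Set.indicator, h, hχ, this]
    · simpa [Set.indicator, h] using hχ0 _

/-- If all admissible strategies exceed `m` with `P`-probability less than `ε`, then up to an error
of order `ε`, the measure `P` is controlled by a martingale measure. -/
lemma exists_martingale_measure (C : ConvexProbFamily Ω) (hS : ∀ i, Measurable fun ω => S1 ω i)
    (hNA : NAcond C.sets S0 S1) {P : Measure Ω} (hP : P ∈ C.sets) {ε : ℝ} (hε : 0 < ε) (m : ℝ)
    (h : ∀ H : Fin d → ℝ, (QS C.sets fun ω => -1 ≤ gain H S0 S1 ω) →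
      P.real {ω | m ≤ gain H S0 S1 ω} < ε) :
    ∃ Q ∈ MartSet C.sets S0 S1, ∀ A, MeasurableSet A →
      lossSlope (m + 1) * P.real A ≤ lossSlope (m + 1) * (2 * ε) + 10 * Q.real A := by
  have hPp := C.isProb P hP
  obtain ⟨T, hT, hT₁, hT₂⟩ := exists_isClosed_forall_notMem_measureReal_lt (S0 := S0) hS (P := P) m ε
  obtain ⟨W, hW, hW0⟩ := exists_complement_null_strategies (S0 := S0) (S1 := S1) C.sets
  obtain ⟨P', hP', hPP', B, hB, hsphere, hTW⟩ := exists_detecting_measure C hS hNA hP hW0 hT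
    fun H hH hqs => (h H hqs).not_ge (hT₁ H hH)
  have hPp' := C.isProb P' hP'
  obtain ⟨ν, hνf, hν2, hνP, hPν, hint, hPA⟩ := exists_reference_measure (S0 := S0) hS hPP' hε
  obtain ⟨μ, hμ, H, hHT, hmin⟩ := exists_minimizer_notMem hν2 hint
    (fun V => (hW V).imp fun K hK => ⟨hK.1, hνP.ae_le (hK.2.ae hP')⟩) hT hB
    (fun H hH hn hae => hsphere H hH hn (hPν.ae_le hae))
    (fun H hH hn hHB hae => hTW H hH hn hHB (hPν.ae_le hae))
  have hν0 : ν ≠ 0 := by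
    rintro rfl
    exact IsProbabilityMeasure.ne_zero P' (Measure.absolutelyContinuous_zero_iff.1 hPν)
  obtain ⟨Q, hQ, hQν, hQ0, hQA⟩ := exists_martingale_of_minimizer hν0 hν2 hμ hint hmin
  refine ⟨Q, ⟨hQ, ⟨P', hP', hQν.trans hνP⟩, fun i => convExp_eq_zero (hQ0 i).1 (hQ0 i).2⟩,
    fun A hA => ?_⟩
  have hms : MeasurableSet {ω | m + 1 < gain H S0 S1 ω} :=
    measurableSet_lt measurable_const (measurable_gain hS H)
  have h₁ := hQA (m + 1) (A \ {ω | m + 1 < gain H S0 S1 ω}) (hA.diff hms)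
    fun ω hω => not_lt.1 hω.2
  have h₂ : Q.real (A \ {ω | m + 1 < gain H S0 S1 ω}) ≤ Q.real A :=
    measureReal_mono Set.sdiff_subset
  have h₃ := hPA _ (hA.diff hms)
  have h₄ : P.real A ≤ P.real (A \ {ω | m + 1 < gain H S0 S1 ω}) +
      P.real {ω | m + 1 < gain H S0 S1 ω} :=
    (measureReal_mono (by rw [Set.sdiff_union_self]; exact Set.subset_union_left)).trans
      (measureReal_union_le _ _)
  have h₅ := hT₂ H hHT
  nlinarith [lossSlope_pos (m + 1)]

end SmallMarket

lemma convExp_eq_zero_iff {Q : Measure Ω} {f : Ω → ℝ} (hf : Measurable f) :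
    convExp Q f = 0 ↔ Integrable f Q ∧ ∫ ω, f ω ∂Q = 0 := by
  refine ⟨fun h => ?_, fun h => convExp_eq_zero h.1 h.2⟩
  have key : ∀ a b : ℝ≥0∞, (a : EReal) - (b : EReal) = 0 → a = b ∧ b ≠ ∞ := by
    intro a b hab
    induction a using ENNReal.recTopCoe <;> induction b using ENNReal.recTopCoe
    · simp at hab
    · simp at hab
    · simp at hab
    · rename_i x y
      refine ⟨?_, ENNReal.coe_ne_top⟩
      have h1 : ((x : ℝ) : EReal) - ((y : ℝ) : EReal) = 0 := hab
      rw [← EReal.coe_sub, EReal.coe_eq_zero, sub_eq_zero] at h1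
      exact congrArg _ (NNReal.coe_injective h1)
  obtain ⟨h1, h2⟩ := key _ _ h
  have hi : Integrable f Q := by
    refine ⟨hf.aestronglyMeasurable, ?_⟩
    rw [hasFiniteIntegral_iff_norm]
    have : ∀ ω, ENNReal.ofReal ‖f ω‖ ≤ ENNReal.ofReal (f ω) + ENNReal.ofReal (-f ω) := by
      intro ω
      rcases le_total 0 (f ω) with h0 | h0
      · rw [Real.norm_eq_abs, abs_of_nonneg h0]
        exact le_self_add
      · rw [Real.norm_eq_abs, abs_of_nonpos h0]
        exact le_add_self
    refine (lintegral_mono this).trans_lt ?_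
    rw [lintegral_add_left (by fun_prop), h1]
    exact ENNReal.add_lt_top.2 ⟨h2.lt_top, h2.lt_top⟩
  refine ⟨hi, ?_⟩
  rw [integral_eq_lintegral_pos_part_sub_lintegral_neg_part hi, h1, sub_self]

/-- The set of martingale measures is stable under midpoints. -/
lemma ConvexProbFamily.half_add_half_mem_martSet (C : ConvexProbFamily Ω) {d : ℕ} {S0 : Fin d → ℝ}
    {S1 : Ω → Fin d → ℝ} (hS : ∀ i, Measurable fun ω => S1 ω i) {Q₁ Q₂ : Measure Ω}
    (h₁ : Q₁ ∈ MartSet C.sets S0 S1) (h₂ : Q₂ ∈ MartSet C.sets S0 S1) :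
    (2⁻¹ : ℝ≥0∞) • Q₁ + (2⁻¹ : ℝ≥0∞) • Q₂ ∈ MartSet C.sets S0 S1 := by
  obtain ⟨hp₁, ⟨P₁, hP₁, hQP₁⟩, hE₁⟩ := h₁
  obtain ⟨hp₂, ⟨P₂, hP₂, hQP₂⟩, hE₂⟩ := h₂
  obtain ⟨P, hP, hPP₁, hPP₂⟩ := C.exists_dominating hP₁ hP₂
  refine ⟨⟨?_⟩, ⟨P, hP, Measure.AbsolutelyContinuous.add_left
    ((hQP₁.trans hPP₁).smul_left _) ((hQP₂.trans hPP₂).smul_left _)⟩, fun i => ?_⟩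
  · simp [ENNReal.inv_two_add_inv_two]
  · have hm : Measurable fun ω => S1 ω i - S0 i := (hS i).sub_const _
    obtain ⟨hi₁, h0₁⟩ := (convExp_eq_zero_iff hm).1 (hE₁ i)
    obtain ⟨hi₂, h0₂⟩ := (convExp_eq_zero_iff hm).1 (hE₂ i)
    have hi₁' := hi₁.smul_measure (c := (2⁻¹ : ℝ≥0∞)) (by simp)
    have hi₂' := hi₂.smul_measure (c := (2⁻¹ : ℝ≥0∞)) (by simp)
    refine convExp_eq_zero (hi₁'.add_measure hi₂') ?_
    rw [integral_add_measure hi₁' hi₂', integral_smul_measure, integral_smul_measure, h0₁, h0₂]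
    simp

lemma exists_forall_le_two_pow_mul {S : Set (Measure Ω)}
    (hS : ∀ Q₁ ∈ S, ∀ Q₂ ∈ S, (2⁻¹ : ℝ≥0∞) • Q₁ + (2⁻¹ : ℝ≥0∞) • Q₂ ∈ S) (K : ℕ)
    (q : ℕ → Measure Ω) (hq : ∀ k, q k ∈ S) :
    ∃ Q ∈ S, ∀ k ≤ K, ∀ A, q k A ≤ 2 ^ (k + 1) * Q A := by
  have hhalf : ∀ x : ℝ≥0∞, x = 2 * (2⁻¹ * x) := fun x => by
    rw [← mul_assoc, ENNReal.mul_inv_cancel (by simp) (by simp), one_mul]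
  induction K generalizing q with
  | zero =>
    refine ⟨q 0, hq 0, fun k hk A => ?_⟩
    obtain rfl := Nat.le_zero.1 hk
    exact le_mul_of_one_le_left' (by norm_num)
  | succ K ih =>
    obtain ⟨Q, hQ, hle⟩ := ih (fun k => q (k + 1)) fun k => hq (k + 1)
    refine ⟨_, hS _ (hq 0) _ hQ, fun k hk A => ?_⟩
    rw [Measure.add_apply, Measure.smul_apply, Measure.smul_apply, smul_eq_mul, smul_eq_mul]
    cases k with
    | zero =>
      rw [zero_add, pow_one, mul_add, ← hhalf]
      exact le_self_add
    | succ k =>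
      refine (hle k (Nat.le_of_succ_le_succ hk) A).trans ?_
      rw [pow_succ _ (k + 1), mul_assoc]
      gcongr
      rw [mul_add, ← hhalf (Q A)]
      exact le_add_self

/-- A Markov inequality for gains under martingale measures. -/
lemma measure_gain_ge_le {d : ℕ} {S0 : Fin d → ℝ} {S1 : Ω → Fin d → ℝ}
    (hS : ∀ i, Measurable fun ω => S1 ω i) {Ps : Set (Measure Ω)} {Q : Measure Ω}
    (hQ : Q ∈ MartSet Ps S0 S1) {H : Fin d → ℝ} {c α : ℝ} (hα : 0 < α) (hc : 0 < c)
    (h : QS Ps fun ω => -c ≤ gain H S0 S1 ω) :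
    Q {ω | α ≤ gain H S0 S1 ω} ≤ ENNReal.ofReal (c / α) := by
  obtain ⟨hp, ⟨P, hP, hQP⟩, hE⟩ := hQ
  have hE' := fun i => (convExp_eq_zero_iff ((hS i).sub_const (S0 i))).1 (hE i)
  have hgi : Integrable (fun ω => gain H S0 S1 ω) Q := integrable_gain (fun i => (hE' i).1) H
  have hg0 : ∫ ω, gain H S0 S1 ω ∂Q = 0 := by
    simp only [gain]
    rw [integral_finsetSum _ fun i _ => (hE' i).1.const_mul (H i)]
    refine Finset.sum_eq_zero fun i _ => ?_
    rw [integral_const_mul, (hE' i).2, mul_zero]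
  have hnn : 0 ≤ᵐ[Q] fun ω => gain H S0 S1 ω + c := by
    filter_upwards [hQP.ae_le (h.ae hP)] with ω hω
    simp only [Pi.zero_apply]
    linarith
  have hM := mul_meas_ge_le_integral_of_nonneg hnn (hgi.add (integrable_const c)) α
  rw [integral_add hgi (integrable_const c), hg0, integral_const, probReal_univ, one_smul,
    zero_add, mul_comm, ← le_div_iff₀ hα] at hM
  have hsub : Q {ω | α ≤ gain H S0 S1 ω} ≤ Q {ω | α ≤ gain H S0 S1 ω + c} :=
    measure_mono fun ω (hω : α ≤ _) => show α ≤ _ by linarith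
  exact hsub.trans ((ENNReal.le_ofReal_iff_toReal_le (measure_ne_top _ _) (by positivity)).2 hM)

section LargeMarketAux

variable {Ωs : ℕ → Type*} [∀ n, MeasurableSpace (Ωs n)]

/-- In the absence of asymptotic arbitrage of the first kind, the gains of admissible strategies
are bounded in probability, asymptotically in the size of the market. -/
lemma exists_forall_measureReal_gain_lt (M : LargeMarket Ωs) (C : ∀ n, ConvexProbFamily (Ωs n))
    (h : NAA1 M fun n => (C n).sets) {P : ∀ n, Measure (Ωs n)} (hP : ∀ n, P n ∈ (C n).sets)
    {ε : ℝ} (hε : 0 < ε) :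
    ∃ (m : ℝ) (N : ℕ), ∀ n ≥ N, ∀ H : Fin (M.d n) → ℝ,
      (QS (C n).sets fun ω => -1 ≤ gain H (M.S0 n) (M.S1 n) ω) →
        (P n).real {ω | m ≤ gain H (M.S0 n) (M.S1 n) ω} < ε := by
  by_contra! hcon
  have hfr : ∀ k : ℕ, ∃ᶠ n in atTop, ∃ H : Fin (M.d n) → ℝ,
      (QS (C n).sets fun ω => -1 ≤ gain H (M.S0 n) (M.S1 n) ω) ∧
        ε ≤ (P n).real {ω | (k : ℝ) + 1 ≤ gain H (M.S0 n) (M.S1 n) ω} := fun k =>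
    frequently_atTop.2 fun N => hcon (k + 1) N
  obtain ⟨nk, hnk, hH⟩ := extraction_forall_of_frequently hfr
  choose H hH₁ hH₂ using hH
  have hpos : ∀ k : ℕ, (0 : ℝ) < (k : ℝ) + 1 := fun k => k.cast_add_one_pos
  refine h ⟨nk, hnk, fun k => ((k : ℝ) + 1)⁻¹ • H k, fun k => ((k : ℝ) + 1)⁻¹,
    fun k => inv_pos.2 (hpos k), ?_, fun k => ?_, min ε 1, by positivity, fun k => P (nk k),
    fun k => hP _, fun k => ?_⟩
  · simpa [one_div] using tendsto_one_div_add_atTop_nhds_zero_nat (𝕜 := ℝ)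
  · obtain ⟨N, hN, h0, h1⟩ := hH₁ k
    refine ⟨N, hN, h0, fun ω hω => ?_⟩
    have h2 : -1 ≤ gain (H k) (M.S0 (nk k)) (M.S1 (nk k)) ω := h1 ω hω
    change -((k : ℝ) + 1)⁻¹ ≤ gain (((k : ℝ) + 1)⁻¹ • H k) (M.S0 (nk k)) (M.S1 (nk k)) ω
    rw [gain_smul]
    nlinarith [inv_pos.2 (hpos k)]
  · have := (C (nk k)).isProb _ (hP (nk k))
    refine (ENNReal.ofReal_le_ofReal ((min_le_left _ _).trans (hH₂ k))).trans ?_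
    rw [ofReal_measureReal]
    refine measure_mono fun ω hω => ?_
    change min ε 1 ≤ gain (((k : ℝ) + 1)⁻¹ • H k) (M.S0 (nk k)) (M.S1 (nk k)) ω
    refine (min_le_right _ _).trans ?_
    rw [gain_smul, le_inv_mul_iff₀ (hpos k), mul_one]
    exact hω

/-- Absence of asymptotic arbitrage of the first kind yields contiguous martingale measures. -/
lemma NAA1.exists_contiguous {M : LargeMarket Ωs} {C : ∀ n, ConvexProbFamily (Ωs n)}
    (hNA : ∀ n, NAcond (C n).sets (M.S0 n) (M.S1 n)) (h : NAA1 M fun n => (C n).sets)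
    {P : ∀ n, Measure (Ωs n)} (hP : ∀ n, P n ∈ (C n).sets) :
    ∃ Q : ∀ n, Measure (Ωs n),
      (∀ n, Q n ∈ MartSet (C n).sets (M.S0 n) (M.S1 n)) ∧ Contiguous P Q := by
  have hpos : ∀ k : ℕ, (0 : ℝ) < 1 / ((k : ℝ) + 1) := fun k => Nat.one_div_pos_of_nat
  choose m N hmN using fun k : ℕ => exists_forall_measureReal_gain_lt M C h hP (hpos k)
  have hq : ∀ n k, ∃ Q ∈ MartSet (C n).sets (M.S0 n) (M.S1 n), N k ≤ n →
      ∀ A, MeasurableSet A → lossSlope (m k + 1) * (P n).real A ≤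
        lossSlope (m k + 1) * (2 * (1 / ((k : ℝ) + 1))) + 10 * Q.real A := by
    intro n k
    have := (C n).isProb _ (hP n)
    by_cases hn : N k ≤ n
    · obtain ⟨Q, hQ, hQA⟩ := exists_martingale_measure (C n) (M.meas_S1 n) (hNA n) (hP n) (hpos k)
        (m k) (hmN k n hn)
      exact ⟨Q, hQ, fun _ => hQA⟩
    · obtain ⟨Q, hQ, -⟩ := exists_martingale_measure (C n) (M.meas_S1 n) (hNA n) (hP n)
        two_pos 0 fun H _ => measureReal_le_one.trans_lt one_lt_two
      exact ⟨Q, hQ, fun hn' => absurd hn' hn⟩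
  choose q hqm hqA using hq
  choose Q hQm hQ using fun n => exists_forall_le_two_pow_mul
    (fun Q₁ h₁ Q₂ h₂ => (C n).half_add_half_mem_martSet (M.meas_S1 n) h₁ h₂) n (q n) (hqm n)
  have hPp : ∀ n, IsProbabilityMeasure (P n) := fun n => (C n).isProb _ (hP n)
  have hQp : ∀ n, IsProbabilityMeasure (Q n) := fun n => (hQm n).1
  refine ⟨Q, hQm, fun A hA hQA => ?_⟩
  have hQr : Tendsto (fun n => (Q n).real (A n)) atTop (𝓝 0) :=
    (ENNReal.tendsto_toReal_zero_iff fun n => measure_ne_top _ _).2 hQA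
  refine (ENNReal.tendsto_toReal_zero_iff fun n => measure_ne_top _ _).1 ?_
  refine tendsto_order.2 ⟨fun a ha => Eventually.of_forall fun n =>
    ha.trans_le ENNReal.toReal_nonneg, fun ε hε => ?_⟩
  obtain ⟨k, hk⟩ := exists_nat_one_div_lt (show (0 : ℝ) < ε / 4 by positivity)
  have hs := lossSlope_pos (m k + 1)
  have hev : ∀ᶠ n in atTop,
      10 * (2 ^ (k + 1) * (Q n).real (A n)) < lossSlope (m k + 1) * (ε / 2) := by
    have : Tendsto (fun n => 10 * (2 ^ (k + 1) * (Q n).real (A n))) atTop (𝓝 0) := by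
      simpa using (hQr.const_mul (2 ^ (k + 1))).const_mul 10
    exact this.eventually_lt_const (by positivity)
  filter_upwards [hev, eventually_ge_atTop (max k (N k))] with n hn hkn
  have h₁ := hqA n k ((le_max_right _ _).trans hkn) (A n) (hA n)
  have h₂ : (q n k).real (A n) ≤ 2 ^ (k + 1) * (Q n).real (A n) := by
    have := ENNReal.toReal_mono (ENNReal.mul_ne_top (by simp) (measure_ne_top _ _))
      (hQ n k ((le_max_left _ _).trans hkn) (A n))
    simpa [ENNReal.toReal_mul, Measure.real] using this
  change (P n).real (A n) < ε
  refine lt_of_mul_lt_mul_left ?_ hs.le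
  nlinarith

/-- An asymptotic arbitrage of the first kind prevents the existence of contiguous martingale
measures. -/
lemma naa1_of_forall_exists_contiguous {M : LargeMarket Ωs} {C : ∀ n, ConvexProbFamily (Ωs n)}
    (h : ∀ P : ∀ n, Measure (Ωs n), (∀ n, P n ∈ (C n).sets) →
      ∃ Q : ∀ n, Measure (Ωs n),
        (∀ n, Q n ∈ MartSet (C n).sets (M.S0 n) (M.S1 n)) ∧ Contiguous P Q) :
    NAA1 M fun n => (C n).sets := by
  rintro ⟨nk, hnk, H, c, hc, hc0, hHc, α, hα, Pk, hPk, hPα⟩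
  have hsel : ∀ n, ∃ P ∈ (C n).sets, ∃ A : Set (Ωs n), MeasurableSet A ∧
      ((∀ k, nk k ≠ n) → A = ∅) ∧ ∀ k, nk k = n → ENNReal.ofReal α ≤ P A ∧
        ∀ Q ∈ MartSet (C n).sets (M.S0 n) (M.S1 n), Q A ≤ ENNReal.ofReal (c k / α) := by
    intro n
    by_cases hn : ∃ k, nk k = n
    · obtain ⟨k, rfl⟩ := hn
      refine ⟨Pk k, hPk k, {ω | α ≤ gain (H k) (M.S0 (nk k)) (M.S1 (nk k)) ω},
        measurableSet_le measurable_const (measurable_gain (M.meas_S1 _) _),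
        fun hne => absurd rfl (hne k), fun j hj => ?_⟩
      obtain rfl := hnk.injective hj
      exact ⟨hPα j, fun Q hQ => measure_gain_ge_le (M.meas_S1 _) hQ hα (hc j) (hHc j)⟩
    · obtain ⟨P, hP⟩ := (C n).nonempty
      exact ⟨P, hP, ∅, MeasurableSet.empty, fun _ => rfl, fun k hk => absurd ⟨k, hk⟩ hn⟩
  choose P hP A hA hA0 hPA using hsel
  obtain ⟨Q, hQ, hcont⟩ := h P hP
  have hlim : Tendsto (fun k => ENNReal.ofReal (c k / α)) atTop (𝓝 0) := by
    simpa using ENNReal.tendsto_ofReal (hc0.div_const α)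
  have hQA : Tendsto (fun n => Q n (A n)) atTop (𝓝 0) := by
    refine ENNReal.tendsto_nhds_zero.2 fun ε hε => ?_
    obtain ⟨K, hK⟩ := eventually_atTop.1 (ENNReal.tendsto_nhds_zero.1 hlim ε hε)
    filter_upwards [eventually_ge_atTop (nk K)] with n hn
    by_cases hk : ∃ k, nk k = n
    · obtain ⟨k, hk⟩ := hk
      exact ((hPA n k hk).2 _ (hQ n)).trans (hK k (hnk.le_iff_le.1 (hk ▸ hn)))
    · rw [hA0 n (not_exists.1 hk), measure_empty]
      exact zero_le
  have hP0 := (hcont A hA hQA).comp hnk.tendsto_atTop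
  have := ge_of_tendsto' hP0 fun k => (hPA (nk k) k rfl).1
  exact (ENNReal.ofReal_pos.2 hα).not_ge this

end LargeMarketAux



/-- **Robust FTAP for large financial markets with NAA1.**  Assume that each small market
satisfies `l(𝕃^∞(𝒫ⁿ)) = Eₙ'` and `NA(𝒫ⁿ)`.  Then `NAA1` holds iff for every sequence
`(Pⁿ)` with `Pⁿ ∈ 𝒫ⁿ` there is a sequence `(Qⁿ)` of dominated martingale measures such
that `(Pⁿ)` is contiguous with respect to `(Qⁿ)`. -/
theorem robust_FTAP_NAA1 {Ωs : ℕ → Type*} [∀ n, MeasurableSpace (Ωs n)]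
    (M : LargeMarket Ωs) (C : ∀ n, ConvexProbFamily (Ωs n))
    (hclosed : ∀ n, DualSurj (C n))
    (hNA : ∀ n, NAcond (C n).sets (M.S0 n) (M.S1 n)) :
    NAA1 M (fun n => (C n).sets) ↔
      ∀ P : ∀ n, Measure (Ωs n), (∀ n, P n ∈ (C n).sets) →
        ∃ Q : ∀ n, Measure (Ωs n),
          (∀ n, Q n ∈ MartSet (C n).sets (M.S0 n) (M.S1 n)) ∧ Contiguous P Q := by
  exact ⟨fun h _ hP => h.exists_contiguous hNA hP, naa1_of_forall_exists_contiguous⟩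

end RobustHS
end

section
/- If 𝒫 is a convex set of probability measures on (Ω,ℱ) that contains all countable convex combinations of its elements (i.e., for any sequence P_n ∈ 𝒫 and weights λ_n ≥ 0 with Σλ_n = 1, the measure Σλ_n P_n belongs to 𝒫), then E equipped with the total variation norm is complete, i.e., a Banach space. -/
open MeasureTheory Filter Topology
open scoped ENNReal NNReal

namespace RobustHS


variable {Ω : Type*} [MeasurableSpace Ω]

theorem tvnorm_withDensity_le (P : Measure Ω) {g : Ω → ℝ} (hg : Integrable g P) :
    tvnorm (P.withDensityᵥ g) ≤ ∫ ω, ‖g ω‖ ∂P := by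
  obtain ⟨i, hi, -, -, heq⟩ := exists_hahn (P.withDensityᵥ g)
  rw [heq, withDensityᵥ_apply hg hi, withDensityᵥ_apply hg hi.compl,
    ← integral_add_compl hi hg.norm]
  have h₁ := (le_abs_self _).trans (norm_integral_le_integral_norm (μ := P.restrict i) g)
  have h₂ := (neg_le_abs _).trans (norm_integral_le_integral_norm (μ := P.restrict iᶜ) g)
  linarith

theorem integral_norm_le_tvnorm_withDensity (P : Measure Ω) {g : Ω → ℝ} (hm : Measurable g)
    (hg : Integrable g P) : ∫ ω, ‖g ω‖ ∂P ≤ tvnorm (P.withDensityᵥ g) := by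
  have hA : MeasurableSet {ω | 0 ≤ g ω} := measurableSet_le measurable_const hm
  refine le_trans (le_of_eq ?_) (apply_sub_compl_le _ hA)
  rw [withDensityᵥ_apply hg hA, withDensityᵥ_apply hg hA.compl, ← integral_add_compl hA hg.norm,
    sub_eq_add_neg, ← integral_neg]
  congr 1
  · exact setIntegral_congr_fun hA fun ω hω => abs_of_nonneg hω
  · exact setIntegral_congr_fun hA.compl fun ω hω => abs_of_neg (not_le.1 hω)

/-- Total variation completeness of the signed measures dominated by a fixed finite measure. -/
theorem exists_tendsto_of_absolutelyContinuous (P : Measure Ω) [IsFiniteMeasure P]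
    (μ : ℕ → SignedMeasure Ω) (hac : ∀ n, μ n ≪ᵥ P.toENNRealVectorMeasure)
    (hcauchy : ∀ ε : ℝ, 0 < ε → ∃ N : ℕ, ∀ m ≥ N, ∀ n ≥ N, tvnorm (μ m - μ n) < ε) :
    ∃ ν : SignedMeasure Ω, ν ≪ᵥ P.toENNRealVectorMeasure ∧
      Tendsto (fun n => tvnorm (μ n - ν)) atTop (nhds 0) := by
  set f : ℕ → Ω → ℝ := fun n => (μ n).rnDeriv P
  have hf : ∀ n, Integrable (f n) P := fun n => SignedMeasure.integrable_rnDeriv _ _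
  have hfm : ∀ n, Measurable (f n) := fun n => SignedMeasure.measurable_rnDeriv _ _
  have hμ : ∀ n, P.withDensityᵥ (f n) = μ n := fun n =>
    (SignedMeasure.absolutelyContinuous_iff_withDensityᵥ_rnDeriv_eq _ _).1 (hac n)
  have hF : CauchySeq fun n => (hf n).toL1 (f n) := by
    refine Metric.cauchySeq_iff.2 fun ε hε => ?_
    obtain ⟨N, hN⟩ := hcauchy ε hε
    refine ⟨N, fun m hm n hn => lt_of_le_of_lt ?_ (hN m hm n hn)⟩
    rw [dist_eq_norm, ← Integrable.toL1_sub, L1.norm_of_fun_eq_integral_norm, ← hμ m, ← hμ n,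
      ← withDensityᵥ_sub (hf m) (hf n)]
    exact integral_norm_le_tvnorm_withDensity P ((hfm m).sub (hfm n)) ((hf m).sub (hf n))
  obtain ⟨g, hg⟩ := cauchySeq_tendsto_of_complete hF
  have hgi : Integrable g P := L1.integrable_coeFn g
  refine ⟨P.withDensityᵥ g, P.withDensityᵥ_absolutelyContinuous g,
    squeeze_zero (fun n => ENNReal.toReal_nonneg) (fun n => ?_)
      (tendsto_iff_norm_sub_tendsto_zero.1 hg)⟩
  calc tvnorm (μ n - P.withDensityᵥ g)
      = tvnorm (P.withDensityᵥ (f n - g)) := by rw [withDensityᵥ_sub (hf n) hgi, hμ]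
    _ ≤ ∫ ω, ‖(f n - ⇑g) ω‖ ∂P := tvnorm_withDensity_le P ((hf n).sub hgi)
    _ = ‖((hf n).sub hgi).toL1 (f n - ⇑g)‖ := (L1.norm_of_fun_eq_integral_norm _).symm
    _ = ‖(hf n).toL1 (f n) - g‖ := by
      rw [Integrable.toL1_sub _ _ (hf n) hgi, Integrable.toL1_coeFn]

/-- **`E` is a Banach space when `Ps` is closed under countable convex combinations.**
Every sequence in `E` which is Cauchy for the total variation norm converges in total
variation to an element of `E`. -/
theorem E_is_complete {Ω : Type*} [MeasurableSpace Ω] (Ps : Set (Measure Ω))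
    (hprob : ∀ P ∈ Ps, IsProbabilityMeasure P) (hconv : MConvex Ps)
    (hcc : ∀ (Pseq : ℕ → Measure Ω) (lam : ℕ → ℝ≥0∞), (∀ n, Pseq n ∈ Ps) →
      (∑' n, lam n) = 1 → Measure.sum (fun n => lam n • Pseq n) ∈ Ps) :
    ∀ μ : ℕ → SignedMeasure Ω, (∀ n, μ n ∈ Edom Ps) →
      (∀ ε : ℝ, 0 < ε → ∃ N : ℕ, ∀ m ≥ N, ∀ n ≥ N, tvnorm (μ m - μ n) < ε) →
      ∃ ν ∈ Edom Ps, Tendsto (fun n => tvnorm (μ n - ν)) atTop (nhds 0) := by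
  intro μ hμ hcauchy
  choose Q hQ hac using hμ
  set P : Measure Ω := Measure.sum fun n => ((2 : ℝ≥0∞)⁻¹ ^ (n + 1)) • Q n with hPdef
  have hP : P ∈ Ps := hcc Q _ hQ (by simp [ENNReal.tsum_geometric_add_one, ENNReal.inv_mul_cancel])
  have := hprob P hP
  have hacP : ∀ n, μ n ≪ᵥ P.toENNRealVectorMeasure := by
    intro n
    refine VectorMeasure.AbsolutelyContinuous.mk fun s hs h => hac n ?_
    rw [Measure.toENNRealVectorMeasure_apply_measurable hs] at h ⊢
    rw [hPdef, Measure.sum_apply _ hs, ENNReal.tsum_eq_zero] at h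
    simpa using h n
  obtain ⟨ν, hν, hlim⟩ := exists_tendsto_of_absolutelyContinuous P μ hacP hcauchy
  exact ⟨ν, ⟨P, hP, hν⟩, hlim⟩

end RobustHS
end

section
/- For every h ∈ 𝕃^∞, the linear functional l_h on E defined by l_h(μ) = ∫_Ω h dμ is continuous, and the embedding l: 𝕃^∞ → E' is isometric: ‖l_h‖_{E'} = ‖h‖_{𝕃^∞}, where ‖l_h‖_{E'} = sup{|l_h(μ)| : μ ∈ E, ‖μ‖ ≤ 1} is the operator norm with respect to the total variation norm on E. -/
open MeasureTheory Filter Topology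
open scoped ENNReal NNReal

namespace RobustHS


variable {Ω : Type*} [MeasurableSpace Ω]

theorem sintegral_eq_of_eq_sub {h : Ω → ℝ} {s : SignedMeasure Ω} {a b : Measure Ω}
    [IsFiniteMeasure a] [IsFiniteMeasure b] (hs : s = a.toSignedMeasure - b.toSignedMeasure)
    (ha : Integrable h a) (hb : Integrable h b)
    (hp : Integrable h s.toJordanDecomposition.posPart)
    (hn : Integrable h s.toJordanDecomposition.negPart) :
    sintegral h s = ∫ ω, h ω ∂a - ∫ ω, h ω ∂b := by
  have key : s.toJordanDecomposition.posPart + b = a + s.toJordanDecomposition.negPart := by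
    rw [← Measure.toSignedMeasure_eq_toSignedMeasure_iff, Measure.toSignedMeasure_add,
      Measure.toSignedMeasure_add, ← sub_eq_sub_iff_add_eq_add, ← hs]
    exact s.toSignedMeasure_toJordanDecomposition
  have hint := congrArg (fun m => ∫ ω, h ω ∂m) key
  simp only [integral_add_measure hp hb, integral_add_measure ha hn] at hint
  rw [sintegral]
  linarith

theorem ae_totalVariation_of_QS {Ps : Set (Measure Ω)} {p : Ω → Prop} (hp : QS Ps p)
    {μ : SignedMeasure Ω} (hμ : μ ∈ Edom Ps) : ∀ᵐ ω ∂μ.totalVariation, p ω := by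
  obtain ⟨N, -, hnull, hN⟩ := hp
  obtain ⟨P, hP, hac⟩ := hμ
  have htv : μ.totalVariation ≪ P := by
    have := (SignedMeasure.absolutelyContinuous_ennreal_iff μ P.toENNRealVectorMeasure).mp hac
    rwa [VectorMeasure.ennrealToMeasure_toENNRealVectorMeasure] at this
  exact measure_mono_null (fun ω hω => by_contra fun hmem => hω (hN ω hmem)) (htv (hnull P hP))

theorem isFiniteMeasure_totalVariation (μ : SignedMeasure Ω) :
    IsFiniteMeasure μ.totalVariation := by
  rw [SignedMeasure.totalVariation]; infer_instance

theorem integrable_totalVariation {Ps : Set (Measure Ω)} {h : Ω → ℝ} (hh : MemLinf Ps h)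
    {μ : SignedMeasure Ω} (hμ : μ ∈ Edom Ps) : Integrable h μ.totalVariation := by
  obtain ⟨hm, M, hM⟩ := hh
  have := isFiniteMeasure_totalVariation μ
  exact Integrable.of_bound hm.aestronglyMeasurable M (ae_totalVariation_of_QS hM hμ)

theorem integrable_posPart {Ps : Set (Measure Ω)} {h : Ω → ℝ} (hh : MemLinf Ps h)
    {μ : SignedMeasure Ω} (hμ : μ ∈ Edom Ps) : Integrable h μ.toJordanDecomposition.posPart :=
  (integrable_totalVariation hh hμ).left_of_add_measure

theorem integrable_negPart {Ps : Set (Measure Ω)} {h : Ω → ℝ} (hh : MemLinf Ps h)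
    {μ : SignedMeasure Ω} (hμ : μ ∈ Edom Ps) : Integrable h μ.toJordanDecomposition.negPart :=
  (integrable_totalVariation hh hμ).right_of_add_measure

theorem sintegral_add (C : ConvexProbFamily Ω) {h : Ω → ℝ} (hh : MemLinf C.sets h)
    (μ ν : Esub C) :
    sintegral h ((μ + ν : Esub C) : SignedMeasure Ω) = sintegral h μ.1 + sintegral h ν.1 := by
  have hs : ((μ + ν : Esub C) : SignedMeasure Ω) =
      (μ.1.toJordanDecomposition.posPart + ν.1.toJordanDecomposition.posPart).toSignedMeasure -
      (μ.1.toJordanDecomposition.negPart + ν.1.toJordanDecomposition.negPart).toSignedMeasure := by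
    rw [Measure.toSignedMeasure_add, Measure.toSignedMeasure_add, add_sub_add_comm]
    exact (congrArg₂ (· + ·) μ.1.toSignedMeasure_toJordanDecomposition
      ν.1.toSignedMeasure_toJordanDecomposition).symm
  have hμp := integrable_posPart hh μ.2
  have hνp := integrable_posPart hh ν.2
  have hμn := integrable_negPart hh μ.2
  have hνn := integrable_negPart hh ν.2
  rw [sintegral_eq_of_eq_sub hs (hμp.add_measure hνp) (hμn.add_measure hνn)
    (integrable_posPart hh (μ + ν).2) (integrable_negPart hh (μ + ν).2),
    integral_add_measure hμp hνp, integral_add_measure hμn hνn, sintegral, sintegral]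
  ring

theorem sintegral_smul (h : Ω → ℝ) (c : ℝ) (s : SignedMeasure Ω) :
    sintegral h (c • s) = c * sintegral h s := by
  rw [sintegral, sintegral, s.toJordanDecomposition_smul_real c, JordanDecomposition.real_smul_def]
  split_ifs with hc
  · rw [JordanDecomposition.smul_posPart, JordanDecomposition.smul_negPart,
      integral_smul_nnreal_measure, integral_smul_nnreal_measure, NNReal.smul_def, NNReal.smul_def,
      Real.coe_toNNReal c hc, smul_eq_mul, smul_eq_mul]
    ring
  · rw [JordanDecomposition.neg_posPart, JordanDecomposition.neg_negPart,
      JordanDecomposition.smul_posPart, JordanDecomposition.smul_negPart,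
      integral_smul_nnreal_measure, integral_smul_nnreal_measure, NNReal.smul_def, NNReal.smul_def,
      Real.coe_toNNReal (-c) (by linarith), smul_eq_mul, smul_eq_mul]
    ring

theorem abs_sintegral_le {Ps : Set (Measure Ω)} {h : Ω → ℝ} {M : ℝ}
    (hM : QS Ps fun ω => |h ω| ≤ M) {μ : SignedMeasure Ω} (hμ : μ ∈ Edom Ps) :
    |sintegral h μ| ≤ M * tvnorm μ := by
  have hae := ae_totalVariation_of_QS hM hμ
  rw [SignedMeasure.totalVariation, ae_add_measure_iff] at hae
  have hp : |∫ ω, h ω ∂μ.toJordanDecomposition.posPart| ≤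
      M * μ.toJordanDecomposition.posPart.real Set.univ :=
    (Real.norm_eq_abs _).symm.trans_le (norm_integral_le_of_norm_le_const hae.1)
  have hn : |∫ ω, h ω ∂μ.toJordanDecomposition.negPart| ≤
      M * μ.toJordanDecomposition.negPart.real Set.univ :=
    (Real.norm_eq_abs _).symm.trans_le (norm_integral_le_of_norm_le_const hae.2)
  have htv : tvnorm μ = μ.toJordanDecomposition.posPart.real Set.univ +
      μ.toJordanDecomposition.negPart.real Set.univ := by
    rw [tvnorm, SignedMeasure.totalVariation, ← measureReal_def, measureReal_add_apply]
  rw [sintegral, htv, mul_add]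
  exact (abs_sub _ _).trans (add_le_add hp hn)

theorem tvnorm_toSignedMeasure_le (ν : Measure Ω) [IsFiniteMeasure ν] :
    tvnorm ν.toSignedMeasure ≤ ν.real Set.univ := by
  obtain ⟨i, hi, -, -, heq⟩ := exists_hahn ν.toSignedMeasure
  rw [heq, Measure.toSignedMeasure_apply_measurable hi,
    Measure.toSignedMeasure_apply_measurable hi.compl]
  have h1 : ν.real i ≤ ν.real Set.univ := measureReal_mono (Set.subset_univ i)
  have h2 : 0 ≤ ν.real iᶜ := measureReal_nonneg
  linarith

theorem toSignedMeasure_mem_Edom {Ps : Set (Measure Ω)} {P ν : Measure Ω} [IsFiniteMeasure ν]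
    (hP : P ∈ Ps) (hν : ν ≪ P) : ν.toSignedMeasure ∈ Edom Ps := by
  refine ⟨P, hP, VectorMeasure.AbsolutelyContinuous.mk fun A hA hPA => ?_⟩
  rw [Measure.toENNRealVectorMeasure_apply_measurable hA] at hPA
  rw [Measure.toSignedMeasure_apply_measurable hA, measureReal_def, hν hPA, ENNReal.toReal_zero]

theorem sintegral_toSignedMeasure_s6 {Ps : Set (Measure Ω)} {h : Ω → ℝ} (hh : MemLinf Ps h)
    {ν : Measure Ω} [IsFiniteMeasure ν] (hν : ν.toSignedMeasure ∈ Edom Ps)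
    (hi : Integrable h ν) : sintegral h ν.toSignedMeasure = ∫ ω, h ω ∂ν := by
  rw [sintegral_eq_of_eq_sub (a := ν) (b := 0) (by simp) hi integrable_zero_measure
    (integrable_posPart hh hν) (integrable_negPart hh hν), integral_zero_measure, sub_zero]

theorem measure_gt_eq_zero_of_setIntegral_le {P : Measure Ω} [IsFiniteMeasure P] {f : Ω → ℝ}
    {c : ℝ} (hf : Integrable f P) (hc : 0 ≤ c)
    (hle : ∫ ω in {ω | c < f ω}, f ω ∂P ≤ c * P.real {ω | c < f ω}) :
    P {ω | c < f ω} = 0 := by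
  by_contra hne
  have := setIntegral_gt_gt hc hf.integrableOn hne
  linarith

theorem qs_abs_le_of_sintegral_le {Ps : Set (Measure Ω)} {h : Ω → ℝ} {c : ℝ}
    (hprob : ∀ P ∈ Ps, IsProbabilityMeasure P) (hh : MemLinf Ps h) (hc : 0 ≤ c)
    (hle : ∀ μ ∈ Edom Ps, |sintegral h μ| ≤ c * tvnorm μ) :
    QS Ps fun ω => |h ω| ≤ c := by
  refine ⟨{ω | c < |h ω|}, measurableSet_lt measurable_const hh.1.abs, fun P hP => ?_,
    fun ω hω => not_lt.1 hω⟩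
  have := hprob P hP
  have hint : Integrable h P := by
    obtain ⟨hm, M, N, -, hnull, hN⟩ := hh
    refine Integrable.of_bound hm.aestronglyMeasurable M (measure_mono_null ?_ (hnull P hP))
    exact fun ω hω => by_contra fun hmem => hω (hN ω hmem)
  have hset (A : Set Ω) : |∫ ω in A, h ω ∂P| ≤ c * P.real A := by
    have hmem := toSignedMeasure_mem_Edom hP (Measure.absolutelyContinuous_of_le
      (Measure.restrict_le_self (μ := P) (s := A)))
    have hbound := hle _ hmem
    rw [sintegral_toSignedMeasure_s6 hh hmem hint.restrict] at hbound
    refine hbound.trans (mul_le_mul_of_nonneg_left ?_ hc)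
    simpa using tvnorm_toSignedMeasure_le (P.restrict A)
  have hpos : P {ω | c < h ω} = 0 :=
    measure_gt_eq_zero_of_setIntegral_le hint hc ((le_abs_self _).trans (hset _))
  have hneg : P {ω | c < -h ω} = 0 := by
    refine measure_gt_eq_zero_of_setIntegral_le hint.neg hc ?_
    rw [integral_neg]
    exact (neg_le_abs _).trans (hset _)
  refine measure_mono_null (fun ω (hω : c < |h ω|) => ?_) (measure_union_null hpos hneg)
  exact lt_abs.mp hω

/-- **The embedding `l : 𝕃^∞ → E'` is well defined and isometric.**  For `h ∈ 𝕃^∞` the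
functional `l_h(μ) = ∫ h dμ` is a continuous linear functional on `E` and its operator
norm equals the `𝕃^∞` norm of `h`. -/
theorem embedding_l_isometric {Ω : Type*} [MeasurableSpace Ω] (C : ConvexProbFamily Ω)
    (h : Ω → ℝ) (hb : MemLinf C.sets h) :
    ∃ y : Esub C →L[ℝ] ℝ, Represents C y h ∧ ‖y‖ = linfNorm C.sets h := by
  have hpos : ∃ M, 0 ≤ M ∧ QS C.sets fun ω => |h ω| ≤ M := by
    obtain ⟨-, M, N, hN, hnull, hM⟩ := hb
    exact ⟨|M|, abs_nonneg M, N, hN, hnull, fun ω hω => (hM ω hω).trans (le_abs_self M)⟩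
  obtain ⟨M, hM₀, hM⟩ := hpos
  let l : Esub C →ₗ[ℝ] ℝ :=
    { toFun := fun μ => sintegral h (μ : SignedMeasure Ω)
      map_add' := sintegral_add C hb
      map_smul' := fun c μ => sintegral_smul h c μ.1 }
  let y : Esub C →L[ℝ] ℝ := l.mkContinuous M fun μ => abs_sintegral_le hM μ.2
  refine ⟨y, fun μ => rfl, le_antisymm ?_ ?_⟩
  · exact le_csInf ⟨M, hM₀, hM⟩ fun K hK =>
      y.opNorm_le_bound hK.1 fun μ => abs_sintegral_le hK.2 μ.2
  · exact csInf_le ⟨0, fun K hK => hK.1⟩ ⟨norm_nonneg y,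
      qs_abs_le_of_sintegral_le C.isProb hb (norm_nonneg y) fun μ hμ => y.le_opNorm ⟨μ, hμ⟩⟩

end RobustHS
end
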